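/- Assume n ≥ 2 and N ≥ 2. Let f be a rational proper map from B_n to B_N in lowest terms, of degree d. Then d ≤ N(N−1)/(2(2n−3)). -/

import Mathlib

open MvPolynomial

/-- `p/q` is a rational proper map from `B_n` to `B_N` in lowest terms:
`q` does not vanish on the closed ball, no nonconstant polynomial divides `q` and
all the `p_i`, `‖p(z)‖ < |q(z)|` on the open ball, and `‖p(z)‖ = |q(z)|` on the sphere. -/
def IsRationalProperBallMap (n N : ℕ) (p : Fin N → MvPolynomial (Fin n) ℂ)
    (q : MvPolynomial (Fin n) ℂ) : Prop :=
  (∀ z : EuclideanSpace ℂ (Fin n), ‖z‖ ≤ 1 → eval (fun i => z i) q ≠ 0) ∧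
  (∀ r : MvPolynomial (Fin n) ℂ, r ∣ q → (∀ i, r ∣ p i) → r.totalDegree = 0) ∧
  (∀ z : EuclideanSpace ℂ (Fin n), ‖z‖ < 1 →
    ∑ i, ‖eval (fun j => z j) (p i)‖ ^ 2 < ‖eval (fun j => z j) q‖ ^ 2) ∧
  (∀ z : EuclideanSpace ℂ (Fin n), ‖z‖ = 1 →
    ∑ i, ‖eval (fun j => z j) (p i)‖ ^ 2 = ‖eval (fun j => z j) q‖ ^ 2)

/-- The degree of a rational map `p/q`: the maximum of the degrees of the
components of the numerator and of the denominator. -/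
def rationalDegree (n N : ℕ) (p : Fin N → MvPolynomial (Fin n) ℂ)
    (q : MvPolynomial (Fin n) ℂ) : ℕ :=
  max (Finset.univ.sup fun i => (p i).totalDegree) q.totalDegree

lemma circle_infinite : {y : ℂ | star y * y = 1}.Infinite := by
  have hne : ∀ a : ℕ, (a : ℂ) - Complex.I ≠ 0 := by
    intro a h
    have := congrArg Complex.im h
    simp at this
  have hne' : ∀ a : ℕ, (a : ℂ) + Complex.I ≠ 0 := by
    intro a h
    have := congrArg Complex.im h
    simp at this
  refine Set.infinite_of_injective_forall_mem
    (f := fun a : ℕ => ((a : ℂ) + Complex.I) / ((a : ℂ) - Complex.I)) ?_ ?_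
  · intro a b hab
    have h2 := (div_eq_div_iff (hne a) (hne b)).1 hab
    have h3 : (2 * Complex.I) * ((b : ℂ) - a) = 0 := by linear_combination h2
    have h4 : (b : ℂ) - a = 0 := by simpa using h3
    exact_mod_cast (sub_eq_zero.1 h4).symm
  · intro a
    change star _ * _ = (1 : ℂ)
    have h1 := hne a
    have h2 := hne' a
    simp only [Complex.star_def, map_div₀, map_add, map_sub, Complex.conj_natCast, Complex.conj_I]
    rw [sub_neg_eq_add, ← sub_eq_add_neg]
    field_simp

open scoped ComplexOrder in
/-- A nonzero polynomial on matrices does not vanish identically on the unitary group. -/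
lemma exists_unitary_eval_ne_zero (n : ℕ) (R : MvPolynomial (Fin n × Fin n) ℂ) (hR : R ≠ 0) :
    ∃ U : Matrix (Fin n) (Fin n) ℂ, U.conjTranspose * U = 1 ∧
      eval (fun ij => U ij.1 ij.2) R ≠ 0 := by
  classical
  have h1 : R * (Matrix.mvPolynomialX (Fin n) (Fin n) ℂ).det ≠ 0 :=
    mul_ne_zero hR (Matrix.det_mvPolynomialX_ne_zero _ _)
  obtain ⟨a, ha⟩ : ∃ a, eval a (R * (Matrix.mvPolynomialX (Fin n) (Fin n) ℂ).det) ≠ 0 := by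
    by_contra! h
    exact h1 (MvPolynomial.funext (by simpa using h))
  rw [map_mul, Matrix.eval_det_mvPolynomialX] at ha
  set A : Matrix (Fin n) (Fin n) ℂ := Matrix.of fun i j => a (i, j) with hA
  have haR : eval (fun ij => A ij.1 ij.2) R ≠ 0 := left_ne_zero_of_mul ha
  have haD : A.det ≠ 0 := right_ne_zero_of_mul ha
  have hU : IsUnit A := (Matrix.isUnit_iff_isUnit_det _).2 (isUnit_iff_ne_zero.2 haD)
  have hpd : (A.conjTranspose * A).PosDef :=
    Matrix.PosDef.conjTranspose_mul_self A (Matrix.mulVec_injective_of_isUnit hU)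
  set V : Matrix (Fin n) (Fin n) ℂ := (hpd.1.eigenvectorUnitary).1 with hV
  have hVV : V.conjTranspose * V = 1 := by
    simpa [Matrix.star_eq_conjTranspose] using (Unitary.coe_star_mul_self hpd.1.eigenvectorUnitary)
  have hVV' : V * V.conjTranspose = 1 := by
    simpa [Matrix.star_eq_conjTranspose] using (Unitary.coe_mul_star_self hpd.1.eigenvectorUnitary)
  let x : Fin n → ℝ := fun i => Real.sqrt (hpd.1.eigenvalues i)
  have hx : ∀ i, 0 < x i := fun i => Real.sqrt_pos.2 (hpd.eigenvalues_pos i)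
  let Dx : Matrix (Fin n) (Fin n) ℂ := Matrix.diagonal fun i => (x i : ℂ)
  let Di : Matrix (Fin n) (Fin n) ℂ := Matrix.diagonal fun i => ((x i)⁻¹ : ℂ)
  have hDD : Di * Dx = 1 := by
    simp only [Di, Dx, Matrix.diagonal_mul_diagonal]
    rw [← Matrix.diagonal_one]; congr 1; ext i
    exact inv_mul_cancel₀ (by exact_mod_cast (hx i).ne')
  have hDD' : Dx * Di = 1 := by
    simp only [Di, Dx, Matrix.diagonal_mul_diagonal]
    rw [← Matrix.diagonal_one]; congr 1; ext i
    exact mul_inv_cancel₀ (by exact_mod_cast (hx i).ne')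
  have hspec : A.conjTranspose * A = V * (Dx * Dx) * V.conjTranspose := by
    have := hpd.1.spectral_theorem
    rw [Unitary.conjStarAlgAut_apply] at this
    refine this.trans ?_
    change V * _ * V.conjTranspose = _
    congr 2
    simp only [Dx, Matrix.diagonal_mul_diagonal]
    congr 1; ext i
    simp only [x, Function.comp]
    rw [← Complex.ofReal_mul, Real.mul_self_sqrt (hpd.eigenvalues_pos i).le]; rfl
  have hDis : Di.conjTranspose = Di := by
    simp [Di, Matrix.diagonal_conjTranspose]
  set W : Matrix (Fin n) (Fin n) ℂ := A * V * Di with hW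
  have hWW : W.conjTranspose * W = 1 := by
    rw [hW, Matrix.conjTranspose_mul, Matrix.conjTranspose_mul, hDis]
    calc Di * (V.conjTranspose * A.conjTranspose) * (A * V * Di)
        = Di * V.conjTranspose * (A.conjTranspose * A) * V * Di := by simp only [Matrix.mul_assoc]
      _ = Di * (V.conjTranspose * V) * (Dx * Dx) * (V.conjTranspose * V) * Di := by
          rw [hspec]; simp only [Matrix.mul_assoc]
      _ = (Di * Dx) * (Dx * Di) := by rw [hVV]; simp only [Matrix.mul_assoc, Matrix.mul_one]
      _ = 1 := by rw [hDD, hDD', Matrix.one_mul]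
  have hAW : A = W * Dx * V.conjTranspose := by
    rw [hW]
    calc A = A * V * (Di * Dx) * V.conjTranspose := by rw [hDD, Matrix.mul_one, Matrix.mul_assoc, hVV', Matrix.mul_one]
      _ = _ := by simp only [Matrix.mul_assoc]
  let S : MvPolynomial (Fin n) ℂ :=
    aeval (fun ij : Fin n × Fin n => ∑ k, C (W ij.1 k) * X k * C (V.conjTranspose k ij.2)) R
  have hS : ∀ y : Fin n → ℂ, eval y S =
      eval (fun ij => (W * Matrix.diagonal y * V.conjTranspose) ij.1 ij.2) R := by
    intro y
    simp only [S]
    rw [aeval_def, eval₂_eq_eval_map, algebraMap_eq, ← MvPolynomial.eval₂_eq_eval_map]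
    rw [← coe_eval₂Hom, ← RingHom.comp_apply, MvPolynomial.comp_eval₂Hom, coe_eval₂Hom]
    have hid : (eval y).comp (C : ℂ →+* MvPolynomial (Fin n) ℂ) = RingHom.id ℂ := by
      ext; simp
    rw [hid, MvPolynomial.eval₂_id]
    congr 1
    congr 1
    ext ij
    rw [Matrix.mul_apply]
    simp [Matrix.mul_diagonal]
  have hS0 : S ≠ 0 := by
    intro h
    apply haR
    have := hS (fun i => (x i : ℂ))
    rw [h, map_zero] at this
    rw [hAW, ← this]
  obtain ⟨y, hy, hyS⟩ : ∃ y : Fin n → ℂ, (∀ i, star (y i) * y i = 1) ∧ eval y S ≠ 0 := by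
    by_contra! h
    apply hS0
    refine MvPolynomial.funext_set (fun _ => {y : ℂ | star y * y = 1}) (fun _ => circle_infinite) ?_
    intro y hy
    rw [map_zero]
    exact h y (fun i => hy i (Set.mem_univ _))
  refine ⟨W * Matrix.diagonal y * V.conjTranspose, ?_, ?_⟩
  · rw [Matrix.conjTranspose_mul, Matrix.conjTranspose_mul, Matrix.conjTranspose_conjTranspose,
      Matrix.diagonal_conjTranspose]
    have hyy : Matrix.diagonal (star y) * Matrix.diagonal y = 1 := by
      rw [Matrix.diagonal_mul_diagonal, ← Matrix.diagonal_one]; congr 1; ext i; exact hy i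
    calc V * (Matrix.diagonal (star y) * W.conjTranspose) * (W * Matrix.diagonal y * V.conjTranspose)
        = V * (Matrix.diagonal (star y) * (W.conjTranspose * W) * Matrix.diagonal y) * V.conjTranspose := by
          simp only [Matrix.mul_assoc]
      _ = 1 := by rw [hWW, Matrix.mul_one, hyy, Matrix.mul_one, hVV']
  · rw [← hS]; exact hyS

lemma clear_den {σ τ : Type*} (num : σ → MvPolynomial τ ℂ) (den : MvPolynomial τ ℂ)
    (Φ : MvPolynomial σ ℂ) : ∃ (k : ℕ) (Ψ : MvPolynomial τ ℂ), ∀ x, eval x den ≠ 0 →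
      eval x Ψ = (eval x den) ^ k * eval (fun i => eval x (num i) / eval x den) Φ := by
  induction Φ using MvPolynomial.induction_on with
  | C a => exact ⟨0, C a, fun x _ => by simp⟩
  | add p q hp hq =>
    obtain ⟨k, P, hP⟩ := hp
    obtain ⟨l, Q, hQ⟩ := hq
    refine ⟨k + l, P * den ^ l + Q * den ^ k, fun x hx => ?_⟩
    simp only [map_add, map_mul, map_pow, hP x hx, hQ x hx]; ring
  | mul_X p i hp =>
    obtain ⟨k, P, hP⟩ := hp
    refine ⟨k + 1, P * num i, fun x hx => ?_⟩
    simp only [map_mul, hP x hx, eval_X]; field_simp; ring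

/-- Zariski density of the sphere in its complexification. -/
lemma sphere_dense (Φ : MvPolynomial (Fin 2 ⊕ Fin 2) ℂ) (z ω : Fin 2 → ℂ)
    (h : z 0 * ω 0 + z 1 * ω 1 = 1) (hΦ : eval (Sum.elim z ω) Φ ≠ 0) :
    ∃ w : Fin 2 → ℂ, w 0 * star (w 0) + w 1 * star (w 1) = 1 ∧
      eval (Sum.elim w (fun i => star (w i))) Φ ≠ 0 := by
  let den : MvPolynomial (Fin 2 × Fin 2) ℂ := X (0,0) * X (1,1) - X (0,1) * X (1,0)
  let num : Fin 2 ⊕ Fin 2 → MvPolynomial (Fin 2 × Fin 2) ℂ :=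
    Sum.elim (fun i => X (i, 0) * den) ![X (1,1), - X (0,1)]
  obtain ⟨k, Ψ, hΨ⟩ := clear_den num den Φ
  have hΨ0 : Ψ ≠ 0 := by
    intro h0
    let A : Fin 2 × Fin 2 → ℂ := fun ij => (!![z 0, - ω 1; z 1, ω 0] : Matrix _ _ ℂ) ij.1 ij.2
    have hd : eval A den = 1 := by simp [A, den]; linear_combination h
    have := hΨ A (by rw [hd]; exact one_ne_zero)
    rw [h0, hd, map_zero, one_pow, one_mul] at this
    apply hΦ
    rw [this]
    congr 1
    congr 1
    ext i
    rcases i with i | i <;> fin_cases i <;> simp [num, hd] <;> simp [A]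
  obtain ⟨U, hU, hUΨ⟩ := exists_unitary_eval_ne_zero 2 Ψ hΨ0
  set A : Fin 2 × Fin 2 → ℂ := fun ij => U ij.1 ij.2 with hA
  have hUd : eval A den = U.det := by simp [Matrix.det_fin_two, A, den]
  have hd0 : U.det ≠ 0 := by
    intro h0
    have := congrArg Matrix.det hU
    rw [Matrix.det_mul, h0] at this
    simp at this
  have h00 := congrFun (congrFun hU 0) 0
  have h01 := congrFun (congrFun hU 0) 1
  simp [Matrix.mul_apply, Fin.sum_univ_two] at h00 h01
  refine ⟨fun i => U i 0, ?_, ?_⟩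
  · simp only [Complex.star_def]; linear_combination h00
  · have h2 := hΨ A (by rw [hUd]; exact hd0)
    rw [h2] at hUΨ
    have h3 := right_ne_zero_of_mul hUΨ
    convert h3 using 3
    ext i
    rcases i with i | i 
    · simp only [num, Sum.elim_inl, map_mul, hUd, eval_X, A]
      field_simp
    · fin_cases i
      · simp only [num, Sum.elim_inr, hUd, A, Complex.star_def]
        rw [eq_div_iff hd0, Matrix.det_fin_two]
        simp
        linear_combination U 1 1 * h00 - U 1 0 * h01
      · simp only [num, Sum.elim_inr, hUd, A, Complex.star_def]
        rw [eq_div_iff hd0, Matrix.det_fin_two]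
        simp
        linear_combination -U 0 1 * h00 + U 0 0 * h01

lemma li_iff_det {κ : Type*} [Fintype κ] [DecidableEq κ] {m : ℕ} (u : Fin m → κ → ℂ) :
    LinearIndependent ℂ u ↔ ∃ Λ : Fin m → κ → ℂ,
      (Matrix.of fun k i => ∑ j, Λ i j * u k j).det ≠ 0 := by
  constructor
  · intro h
    have hinj : LinearMap.ker (Fintype.linearCombination ℂ u) = ⊥ :=
      LinearMap.ker_eq_bot.2 (linearIndependent_iff_injective_fintypeLinearCombination.1 h)
    obtain ⟨l, hl⟩ := LinearMap.exists_leftInverse_of_injective _ hinj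
    refine ⟨fun i j => l (Pi.single j 1) i, ?_⟩
    have : (Matrix.of fun k i => ∑ j, l (Pi.single j 1) i * u k j) = 1 := by
      ext k i
      have h1 : l (u k) = Pi.single k 1 := by
        have := LinearMap.congr_fun hl (Pi.single k 1)
        simpa [Fintype.linearCombination_apply_single] using this
      have h2 : u k = ∑ j, u k j • (Pi.single j (1:ℂ)) := by
        ext j; simp [Finset.sum_apply, Pi.single_apply]
      have h3 : l (u k) i = ∑ j, l (Pi.single j 1) i * u k j := by
        conv_lhs => rw [h2]
        simp [map_sum, Finset.sum_apply, mul_comm]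
      rw [Matrix.of_apply, ← h3, h1]
      simp [Matrix.one_apply, Pi.single_apply, eq_comm]
    rw [this, Matrix.det_one]; exact one_ne_zero
  · rintro ⟨Λ, h⟩
    have h1 := Matrix.linearIndependent_rows_of_det_ne_zero h
    let l : (κ → ℂ) →ₗ[ℂ] (Fin m → ℂ) := Matrix.toLin' (Matrix.of Λ)
    apply LinearIndependent.of_comp l
    have h2 : (l ∘ u) = fun i => Matrix.of (fun k i => ∑ j, Λ i j * u k j) i := by
      funext k i
      simp [l, Matrix.mulVec, dotProduct]
    rw [h2]
    exact h1

lemma wronsk {κ : Type*} [Fintype κ] [DecidableEq κ] (f : κ → Polynomial ℂ) (r : ℕ)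
    (hli : LinearIndependent ℂ (fun (k : Fin (r+1)) (j : κ) => (f j).coeff k))
    (hK : ∃ K : ℕ, (fun j => (f j).coeff K) ∉
      Submodule.span ℂ (Set.range (fun (k : Fin (r+1)) (j : κ) => (f j).coeff k))) :
    ∃ t : ℂ, LinearIndependent ℂ
      (fun (k : Fin (r+2)) (j : κ) => (Polynomial.taylor t (f j)).coeff k) := by
  classical
  obtain ⟨K, hK1, hK2⟩ : ∃ K : ℕ, (fun j => (f j).coeff K) ∉
      Submodule.span ℂ (Set.range (fun (k : Fin (r+1)) (j : κ) => (f j).coeff k)) ∧ 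
      ∀ n < K, (fun j => (f j).coeff n) ∈
      Submodule.span ℂ (Set.range (fun (k : Fin (r+1)) (j : κ) => (f j).coeff k)) :=
    ⟨Nat.find hK, Nat.find_spec hK, fun n hn => not_not.1 (Nat.find_min hK hn)⟩
  have hrK : r + 1 ≤ K := by
    by_contra! h
    exact hK1 (Submodule.subset_span ⟨⟨K, h⟩, rfl⟩)
  let v : ℕ → κ → ℂ := fun n j => (f j).coeff n
  let u : Fin (r+2) → κ → ℂ := Fin.snoc (fun k : Fin (r+1) => v k) (v K)
  have hu : LinearIndependent ℂ u := linearIndependent_finSnoc.2 ⟨hli, hK1⟩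
  have hinj : LinearMap.ker (Fintype.linearCombination ℂ u) = ⊥ :=
      LinearMap.ker_eq_bot.2 (linearIndependent_iff_injective_fintypeLinearCombination.1 hu)
  obtain ⟨l, hl⟩ := LinearMap.exists_leftInverse_of_injective _ hinj
  have hlu : ∀ i, l (u i) = Pi.single i 1 := by
    intro k
    have := LinearMap.congr_fun hl (Pi.single k 1)
    simpa [Fintype.linearCombination_apply_single] using this
  let Λ : Fin (r+2) → κ → ℂ := fun i j => l (Pi.single j 1) i
  have hΛ : ∀ w i, ∑ j, Λ i j * w j = l w i := by
    intro w i
    have h2 : w = ∑ j, w j • (Pi.single j (1:ℂ)) := by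
      ext j; simp [Finset.sum_apply, Pi.single_apply]
    conv_rhs => rw [h2]
    simp [map_sum, Finset.sum_apply, mul_comm, Λ]
  let φ : Fin (r+2) → Polynomial ℂ := fun i => ∑ j, Polynomial.C (Λ i j) * f j
  have hφ : ∀ i n, (φ i).coeff n = l (v n) i := by
    intro i n
    simp only [φ, Polynomial.finsetSum_coeff, Polynomial.coeff_C_mul]
    exact hΛ (v n) i
  have hlv : ∀ (n : ℕ) (hn : n < r + 1), l (v n) = Pi.single ⟨n, by omega⟩ 1 := by
    intro n hn
    rw [← hlu]
    congr 1
    exact (Fin.snoc_castSucc (α := fun _ => κ → ℂ) (v K) (fun k : Fin (r+1) => v k) ⟨n, hn⟩).symm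
  have hlK : l (v K) = Pi.single (Fin.last (r+1)) 1 := by
    rw [← hlu]; congr 1
    exact (Fin.snoc_last (α := fun _ => κ → ℂ) (v K) (fun k : Fin (r+1) => v k)).symm
  have hlt : ∀ n < K, l (v n) (Fin.last (r+1)) = 0 := by
    intro n hn
    have : Submodule.span ℂ (Set.range (fun (k : Fin (r+1)) (j : κ) => (f j).coeff k)) ≤
        LinearMap.ker ((LinearMap.proj (Fin.last (r+1))).comp l) := by
      rw [Submodule.span_le]
      rintro _ ⟨k, rfl⟩
      change l (v k) (Fin.last (r+1)) = 0
      rw [hlv k k.2]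
      rw [Pi.single_apply, if_neg]
      intro h
      have := congrArg Fin.val h
      simp at this
      omega
    exact this (hK2 n hn)
  let e := K - (r+1)
  have hdiv : ∀ k : Fin (r+2), ∃ h : Polynomial ℂ,
      Polynomial.hasseDeriv k (φ (Fin.last (r+1))) = h * Polynomial.X ^ e ∧
      h.eval 0 = if k = Fin.last (r+1) then (K.choose (r+1) : ℂ) else 0 := by
    intro k
    have h1 : Polynomial.X ^ e ∣ Polynomial.hasseDeriv k (φ (Fin.last (r+1))) := by
      rw [Polynomial.X_pow_dvd_iff]
      intro n hn
      rw [Polynomial.hasseDeriv_coeff, hφ, hlt _ (by omega), mul_zero]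
    obtain ⟨h, hh⟩ := h1
    refine ⟨h, by rw [hh, mul_comm], ?_⟩
    have h2 : (Polynomial.hasseDeriv k (φ (Fin.last (r+1)))).coeff e = h.eval 0 := by
      rw [hh, Polynomial.coeff_X_pow_mul', if_pos le_rfl, Nat.sub_self, Polynomial.coeff_zero_eq_eval_zero]
    rw [← h2, Polynomial.hasseDeriv_coeff, hφ]
    split_ifs with hk
    · subst hk
      have : e + ((Fin.last (r+1) : Fin (r+2)) : ℕ) = K := by simp [e]; omega
      rw [this, hlK]
      simp
    · have : (k : ℕ) < r + 1 := by
        have := k.2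
        have h3 : (k : ℕ) ≠ r + 1 := fun h => hk (Fin.ext h)
        omega
      rw [hlt _ (by omega), mul_zero]
  choose h hh1 hh2 using hdiv
  let M : Matrix (Fin (r+2)) (Fin (r+2)) (Polynomial ℂ) :=
    Matrix.of fun k i => Polynomial.hasseDeriv k (φ i)
  let M' : Matrix (Fin (r+2)) (Fin (r+2)) (Polynomial ℂ) :=
    Matrix.of fun k i => if i = Fin.last (r+1) then h k else Polynomial.hasseDeriv k (φ i)
  let dg : Fin (r+2) → Polynomial ℂ := fun i => if i = Fin.last (r+1) then Polynomial.X ^ e else 1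
  have hMM : M = M' * Matrix.diagonal dg := by
    ext1 k i
    rw [Matrix.mul_diagonal]
    simp only [M, M', dg, Matrix.of_apply]
    split_ifs with hi
    · rw [hi, hh1]
    · rw [mul_one]
  have hM'0 : (M'.map (Polynomial.evalRingHom 0)).det ≠ 0 := by
    rw [Matrix.det_of_isLowerTriangular]
    · rw [Finset.prod_ne_zero_iff]
      intro i _
      simp only [M', Matrix.map_apply, Matrix.of_apply]
      split_ifs with hi
      · rw [Polynomial.coe_evalRingHom, hh2, if_pos hi]
        exact_mod_cast (Nat.choose_pos hrK).ne'
      · have : (i : ℕ) < r + 1 := by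
          have := i.2
          have h3 : (i : ℕ) ≠ r + 1 := fun h => hi (Fin.ext h)
          omega
        rw [Polynomial.coe_evalRingHom, ← Polynomial.coeff_zero_eq_eval_zero, Polynomial.hasseDeriv_coeff, hφ, zero_add, hlv _ this]
        simp
    · intro k i hki
      have hki : k < i := hki
      have hk : (k : ℕ) < r + 1 := by have := i.2; have : (k : ℕ) < i := hki; omega
      simp only [M', Matrix.map_apply, Matrix.of_apply]
      split_ifs with hi
      · rw [Polynomial.coe_evalRingHom, hh2, if_neg (by rw [← hi]; exact hki.ne)]
      · rw [Polynomial.coe_evalRingHom, ← Polynomial.coeff_zero_eq_eval_zero, Polynomial.hasseDeriv_coeff, hφ, zero_add, hlv _ hk]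
        simp [hki.ne']
  have hdet : M.det ≠ 0 := by
    rw [hMM, Matrix.det_mul, Matrix.det_diagonal]
    apply mul_ne_zero
    · intro h0
      apply hM'0
      have := RingHom.map_det (Polynomial.evalRingHom (0:ℂ)) M'
      rw [h0, map_zero] at this
      exact this.symm
    · rw [Finset.prod_ne_zero_iff]
      intro i _
      simp only [dg]
      split_ifs
      · exact pow_ne_zero _ Polynomial.X_ne_zero
      · exact one_ne_zero
  obtain ⟨t, ht⟩ : ∃ t, M.det.eval t ≠ 0 := by
    by_contra! h0
    exact hdet (Polynomial.funext (by simpa using h0))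
  refine ⟨t, (li_iff_det _).2 ⟨Λ, ?_⟩⟩
  have h5 := RingHom.map_det (Polynomial.evalRingHom t) M
  rw [Polynomial.coe_evalRingHom] at h5
  rw [h5] at ht
  convert ht using 2
  ext k i
  simp [M, φ, Polynomial.taylor_coeff, Polynomial.eval_finsetSum]
  refine Finset.sum_congr rfl fun j _ => ?_
  rw [← Polynomial.smul_eq_C_mul, map_smul, Polynomial.eval_smul, smul_eq_mul]

/-- No common zero on the projective line, as forms of degree `D`. -/
def GoodFam {κ : Type*} (D : ℕ) (f : κ → Polynomial ℂ) : Prop :=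
  (∀ j, (f j).natDegree ≤ D) ∧ (∀ s, ∃ j, (f j).eval s ≠ 0) ∧ ∃ j, (f j).coeff D ≠ 0

lemma good_to_res {κ : Type*} [Fintype κ] {D : ℕ} {f : κ → Polynomial ℂ} (h : GoodFam D f) :
    ∃ (j : κ) (e : κ → ℂ),
      Polynomial.resultant (f j) (∑ i, Polynomial.C (e i) * f i) D D ≠ 0 := by
  classical
  obtain ⟨h1, h2, j, hj⟩ := h
  have hfj : f j ≠ 0 := by rintro h0; simp [h0] at hj
  have hdeg : (f j).natDegree = D := le_antisymm (h1 j) (Polynomial.le_natDegree_of_ne_zero hj)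
  let P : MvPolynomial κ ℂ := ∏ s ∈ (f j).roots.toFinset, ∑ i, C ((f i).eval s) * X i
  have hP : P ≠ 0 := by
    rw [Finset.prod_ne_zero_iff]
    intro s _ h0
    obtain ⟨i, hi⟩ := h2 s
    apply hi
    have := congrArg (eval (Pi.single i 1)) h0
    simpa [Pi.single_apply] using this
  obtain ⟨e, he⟩ : ∃ e, eval e P ≠ 0 := by
    by_contra! h0
    exact hP (MvPolynomial.funext (by simpa using h0))
  refine ⟨j, e, ?_⟩
  set g := ∑ i, Polynomial.C (e i) * f i with hg
  have hgd : g.natDegree ≤ D :=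
    Polynomial.natDegree_sum_le_of_forall_le _ _ fun i _ =>
      (Polynomial.natDegree_C_mul_le _ _).trans (h1 i)
  have hcop : IsCoprime (f j) g := by
    rw [Polynomial.isCoprime_iff_aeval_ne_zero_of_isAlgClosed ℂ ℂ]
    intro s
    by_contra! h0
    simp only [Polynomial.coe_aeval_eq_eval] at h0
    have hs : s ∈ (f j).roots.toFinset := by
      rw [Multiset.mem_toFinset, Polynomial.mem_roots hfj]; exact h0.1
    simp only [P, map_prod] at he
    apply Finset.prod_ne_zero_iff.1 he s hs
    have := h0.2
    simp only [hg, Polynomial.eval_finsetSum, Polynomial.eval_mul, Polynomial.eval_C] at this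
    simp only [map_sum, map_mul, eval_C, eval_X]
    rw [← this]
    exact Finset.sum_congr rfl fun i _ => mul_comm _ _
  have h3 := Polynomial.resultant_ne_zero _ _ hcop
  rw [hdeg] at h3
  obtain ⟨k, hk⟩ := Nat.exists_eq_add_of_le hgd
  have h4 := Polynomial.resultant_add_right_deg (f j) g D g.natDegree k le_rfl
  rw [← hk] at h4
  rw [h4]
  exact mul_ne_zero (pow_ne_zero _ hj) h3

lemma res_to_good {κ : Type*} [Fintype κ] {D : ℕ} (hD : D ≠ 0) {f : κ → Polynomial ℂ}
    (h1 : ∀ j, (f j).natDegree ≤ D) (j : κ) (e : κ → ℂ)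
    (h : Polynomial.resultant (f j) (∑ i, Polynomial.C (e i) * f i) D D ≠ 0) : GoodFam D f := by
  set g := ∑ i, Polynomial.C (e i) * f i with hg
  have hgd : g.natDegree ≤ D :=
    Polynomial.natDegree_sum_le_of_forall_le _ _ fun i _ =>
      (Polynomial.natDegree_C_mul_le _ _).trans (h1 i)
  refine ⟨h1, ?_, ?_⟩
  · intro s
    by_contra! h0
    obtain ⟨p, q, -, -, hpq⟩ := Polynomial.exists_mul_add_mul_eq_C_resultant (f j) g (h1 j) hgd (Or.inl hD)
    have := congrArg (Polynomial.eval s) hpq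
    simp [h0, hg, Polynomial.eval_finsetSum] at this
    exact h this.symm
  · by_contra! h0
    apply h
    have hlt : ∀ p : Polynomial ℂ, p.natDegree ≤ D → p.coeff D = 0 → p.natDegree < D := by
      intro p hp hc
      refine lt_of_le_of_ne hp fun h => ?_
      rw [← h, Polynomial.coeff_natDegree, Polynomial.leadingCoeff_eq_zero] at hc
      rw [hc] at h; simp at h; exact hD h.symm
    apply Polynomial.resultant_eq_zero_of_lt_lt
    · exact hlt _ (h1 j) (h0 j)
    · apply hlt _ hgd
      simp [hg, Polynomial.finsetSum_coeff, h0]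

lemma dvd_of_no_common_root {κ : Type*} [Fintype κ] (f : κ → Polynomial ℂ)
    (hf : ∀ s, ∃ j, (f j).eval s ≠ 0) (g Δ : Polynomial ℂ) (h : ∀ j, g ∣ Δ * f j) : g ∣ Δ := by
  have htop : Ideal.span (Set.range f) = ⊤ := by
    obtain ⟨a, ha⟩ := (IsPrincipalIdealRing.principal (Ideal.span (Set.range f))).principal
    rw [Ideal.submodule_span_eq] at ha
    rw [ha, Ideal.span_singleton_eq_top]
    by_contra hu
    have hdvd : ∀ j, a ∣ f j := fun j => by
      rw [← Ideal.mem_span_singleton, ← ha]; exact Ideal.subset_span ⟨j, rfl⟩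
    obtain ⟨s, hs⟩ : ∃ s, a.eval s = 0 := by
      by_cases h0 : a.degree = 0
      · exact absurd (Polynomial.isUnit_iff_degree_eq_zero.2 h0) hu
      · obtain ⟨s, hs⟩ := IsAlgClosed.exists_root a h0
        exact ⟨s, hs⟩
    obtain ⟨j, hj⟩ := hf s
    obtain ⟨b, hb⟩ := hdvd j
    apply hj; rw [hb, Polynomial.eval_mul, hs, zero_mul]
  have h1 : (1 : Polynomial ℂ) ∈ Ideal.span (Set.range f) := by rw [htop]; trivial
  rw [Ideal.mem_span_range_iff_exists_fun] at h1
  obtain ⟨c, hc⟩ := h1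
  rw [← mul_one Δ, ← hc, Finset.mul_sum]
  refine Finset.dvd_sum fun j _ => ?_
  rw [mul_left_comm]
  exact (h j).mul_left _

lemma det_degree_le (r : ℕ) (T : Matrix (Fin r) (Fin r) (Polynomial ℂ))
    (hT : ∀ k i, (T k i).natDegree ≤ (k : ℕ) + 1) : T.det.natDegree ≤ r * (r + 1) / 2 := by
  rw [Matrix.det_apply]
  refine Polynomial.natDegree_sum_le_of_forall_le _ _ fun σ _ => ?_
  refine (Polynomial.natDegree_smul_le _ _).trans ?_
  refine (Polynomial.natDegree_prod_le _ _).trans ?_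
  refine (Finset.sum_le_sum fun i _ => hT (σ i) i).trans ?_
  rw [Equiv.sum_comp σ (fun i : Fin r => (i : ℕ) + 1), Fin.sum_univ_eq_sum_range (fun i => i + 1)]
  have h1 : ∑ i ∈ Finset.range r, (i + 1) = ∑ i ∈ Finset.range (r+1), i := by
    rw [Finset.sum_range_succ']; simp
  rw [h1, Finset.sum_range_id, Nat.add_sub_cancel, mul_comm]

lemma cramer_bound (r : ℕ) (a0 : Polynomial ℂ) (a : Fin r → Polynomial ℂ)
    (T : Matrix (Fin r) (Fin r) (Polynomial ℂ)) (T0 : Fin r → Polynomial ℂ)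
    (hT : ∀ k i, (T k i).natDegree ≤ (k : ℕ) + 1) (hT0 : ∀ k, (T0 k).natDegree ≤ (k : ℕ) + 1)
    (hdet : T.det ≠ 0) (heq : ∀ k, a0 * T0 k + ∑ i, T k i * a i = 0)
    (hcop : ∀ s, a0.eval s ≠ 0 ∨ ∃ i, (a i).eval s ≠ 0) :
    a0.natDegree ≤ r * (r + 1) / 2 ∧ ∀ i, (a i).natDegree ≤ r * (r + 1) / 2 := by
  have hΔ := det_degree_le r T hT
  have hC : ∀ i, (T.cramer T0 i).natDegree ≤ r * (r + 1) / 2 := by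
    intro i
    rw [Matrix.cramer_apply]
    apply det_degree_le
    intro k l
    rw [Matrix.updateCol_apply]
    split_ifs
    · exact hT0 k
    · exact hT k l
  have hmul : T.mulVec a = -a0 • T0 := by
    ext1 k
    have := heq k
    simp only [Matrix.mulVec, dotProduct, Pi.smul_apply, smul_eq_mul]
    linear_combination this
  have hcr : ∀ i, T.det * a i = a0 * - T.cramer T0 i := by
    intro i
    have h1 : T.adjugate.mulVec (T.mulVec a) = T.det • a := by
      rw [Matrix.mulVec_mulVec, Matrix.adjugate_mul, Matrix.smul_mulVec, Matrix.one_mulVec]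
    rw [hmul, ← Matrix.cramer_eq_adjugate_mulVec, map_smul] at h1
    have := congrFun h1 i
    simp only [Pi.smul_apply, smul_eq_mul] at this
    rw [← this]; ring
  have hdvd : a0 ∣ T.det := by
    refine dvd_of_no_common_root (κ := Option (Fin r)) (fun o => o.elim a0 a) ?_ _ _ ?_
    · intro s
      rcases hcop s with h | ⟨i, h⟩
      · exact ⟨none, h⟩
      · exact ⟨some i, h⟩
    · rintro (_ | i)
      · exact Dvd.intro_left _ rfl
      · exact ⟨_, hcr i⟩
  refine ⟨(Polynomial.natDegree_le_of_dvd hdvd hdet).trans hΔ, fun i => ?_⟩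
  obtain ⟨e, he⟩ := hdvd
  have ha0 : a0 ≠ 0 := by rintro rfl; simp at he; exact hdet he
  have he0 : e ≠ 0 := by rintro rfl; simp at he; exact hdet he
  have h1 : e * a i = - T.cramer T0 i := by
    apply mul_left_cancel₀ ha0
    rw [← hcr i, he]; ring
  by_cases hai : a i = 0
  · simp [hai]
  calc (a i).natDegree ≤ (e * a i).natDegree := by
        rw [Polynomial.natDegree_mul he0 hai]; omega
    _ ≤ _ := by rw [h1, Polynomial.natDegree_neg]; exact hC i

lemma exists_C_mem_span {S : Type*} [CommRing S] [IsDomain S] [UniqueFactorizationMonoid S]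
    {κ : Type*} [Fintype κ] (G : κ → Polynomial S) (hne : ∃ j, G j ≠ 0)
    (hG : ∀ h : Polynomial S, (∀ j, h ∣ G j) → h.natDegree = 0) :
    ∃ R : S, R ≠ 0 ∧ Polynomial.C R ∈ Ideal.span (Set.range G) := by
  classical
  let K := FractionRing S
  obtain ⟨_⟩ : Nonempty (NormalizedGCDMonoid S) :=
    inferInstance
  let φ : Polynomial S →+* Polynomial K := Polynomial.mapRingHom (algebraMap S K)
  have hφ : Function.Injective φ :=
    Polynomial.map_injective _ (IsFractionRing.injective S K)
  obtain ⟨h, hh⟩ := (IsPrincipalIdealRing.principal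
    (Ideal.span (Set.range fun j => φ (G j)))).principal
  rw [Ideal.submodule_span_eq] at hh
  have hdvd : ∀ j, h ∣ φ (G j) := fun j => by
    rw [← Ideal.mem_span_singleton, ← hh]
    exact Ideal.subset_span ⟨j, rfl⟩
  have h0 : h ≠ 0 := by
    rintro rfl
    obtain ⟨j, hj⟩ := hne
    have := hdvd j
    rw [zero_dvd_iff, map_eq_zero_iff _ hφ] at this
    exact hj this
  have hu : IsUnit h := by
    set h1 := IsLocalization.integerNormalization (nonZeroDivisors S) h
    obtain ⟨c, hc, hc1⟩ := IsLocalization.integerNormalization_spec (nonZeroDivisors S) h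
    have hc0 : algebraMap S K c ≠ 0 := by
      simpa using nonZeroDivisors.ne_zero hc
    apply Polynomial.isUnit_or_eq_zero_of_isUnit_integerNormalization_primPart (R := S) h0
    have hdeg : (h1.primPart).natDegree = 0 := by
      apply hG
      intro j
      apply h1.isPrimitive_primPart.dvd_of_fraction_map_dvd_fraction_map (K := K)
      have e1 : h1.primPart.map (algebraMap S K) ∣ h1.map (algebraMap S K) :=
        (Polynomial.mapRingHom (algebraMap S K)).map_dvd h1.primPart_dvd
      refine e1.trans ?_
      rw [hc1]
      rw [Algebra.smul_def, Polynomial.algebraMap_apply]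
      refine dvd_trans ?_ (hdvd j)
      exact ((Polynomial.isUnit_C.2 (isUnit_iff_ne_zero.2 hc0)).mul_left_dvd).2 dvd_rfl
    have := h1.isPrimitive_primPart
    rw [Polynomial.eq_C_of_natDegree_eq_zero hdeg] at this ⊢
    exact Polynomial.isUnit_C.2 (this _ dvd_rfl)
  have h1 : (1 : Polynomial K) ∈ Ideal.span (Set.range fun j => φ (G j)) := by
    rw [hh, Ideal.span_singleton_eq_top.2 hu]; trivial
  obtain ⟨c, hc⟩ := Ideal.mem_span_range_iff_exists_fun.1 h1
  choose b hb hbc using fun j =>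
    IsLocalization.integerNormalization_spec (nonZeroDivisors S) (c j)
  refine ⟨∏ j, b j, Finset.prod_ne_zero_iff.2 fun j _ => nonZeroDivisors.ne_zero (hb j), ?_⟩
  rw [Ideal.mem_span_range_iff_exists_fun]
  refine ⟨fun j => Polynomial.C (∏ i ∈ Finset.univ.erase j, b i) *
    IsLocalization.integerNormalization (nonZeroDivisors S) (c j), ?_⟩
  apply hφ
  rw [map_sum]
  have : ∀ j, φ (Polynomial.C (∏ i ∈ Finset.univ.erase j, b i) *
    IsLocalization.integerNormalization (nonZeroDivisors S) (c j) * G j)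
      = φ (Polynomial.C (∏ j, b j)) * (c j * φ (G j)) := by
    intro j
    rw [map_mul, map_mul]
    have e : φ (IsLocalization.integerNormalization (nonZeroDivisors S) (c j))
      = φ (Polynomial.C (b j)) * c j := by
      rw [Polynomial.coe_mapRingHom, hbc, Algebra.smul_def, Polynomial.algebraMap_apply]
      simp
    rw [e, ← Finset.prod_erase_mul _ _ (Finset.mem_univ j), Polynomial.C_mul, map_mul]
    ring
  simp_rw [this]
  rw [← Finset.mul_sum, hc, mul_one]

lemma line_top_coeff {n : ℕ} (F : MvPolynomial (Fin n) ℂ) (d : ℕ) (hd : F.totalDegree ≤ d)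
    (a b : Fin n → ℂ) :
    (aeval (fun i => Polynomial.C (a i) + Polynomial.X * Polynomial.C (b i)) F).coeff d
      = eval b (homogeneousComponent d F) := by
  set l : Fin n → Polynomial ℂ := fun i => Polynomial.C (a i) + Polynomial.X * Polynomial.C (b i)
    with hl
  have hl1 : ∀ i, (l i).natDegree ≤ 1 := by intro i; simp only [hl]; compute_degree
  have hl2 : ∀ i, (l i).coeff 1 = b i := by
    intro i; simp [hl, Polynomial.coeff_C]
  have key : ∀ (m : Fin n →₀ ℕ) (s : Finset (Fin n)),
      (∏ i ∈ s, l i ^ m i).natDegree ≤ ∑ i ∈ s, m i ∧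
      (∏ i ∈ s, l i ^ m i).coeff (∑ i ∈ s, m i) = ∏ i ∈ s, b i ^ m i := by
    intro m s
    induction s using Finset.induction_on with
    | empty => simp
    | insert i s hi ih =>
      have h1 : (l i ^ m i).natDegree ≤ m i := by
        simpa using Polynomial.natDegree_pow_le_of_le (m i) (hl1 i)
      have h2 : (l i ^ m i).coeff (m i) = b i ^ m i := by
        have := Polynomial.coeff_pow_of_natDegree_le (m := m i) (hl1 i)
        rwa [mul_one, hl2] at this
      rw [Finset.prod_insert hi, Finset.prod_insert hi, Finset.sum_insert hi]
      refine ⟨(Polynomial.natDegree_mul_le).trans (add_le_add h1 ih.1), ?_⟩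
      rw [Polynomial.coeff_mul_add_eq_of_natDegree_le h1 ih.1, h2, ih.2]
  rw [homogeneousComponent_apply, map_sum]
  conv_lhs => rw [F.as_sum, map_sum, Polynomial.finsetSum_coeff]
  rw [Finset.sum_filter]
  refine Finset.sum_congr rfl fun m hm => ?_
  rw [aeval_monomial, Finsupp.prod_fintype _ _ (by simp), Polynomial.algebraMap_apply]
  simp only [Algebra.algebraMap_self, RingHom.id_apply, Polynomial.coeff_C_mul]
  have hdeg : m.degree = ∑ i, m i := Finsupp.degree_eq_sum m
  have hmd : m.degree ≤ d := by
    refine le_trans ?_ hd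
    have := le_totalDegree hm
    rwa [Finsupp.sum_fintype _ _ (by simp), ← hdeg] at this
  split_ifs with h
  · rw [← h, hdeg, (key m _).2, eval_monomial, Finsupp.prod_fintype _ _ (by simp)]
  · rw [Polynomial.coeff_eq_zero_of_natDegree_lt, mul_zero]
    refine (key m _).1.trans_lt ?_
    rw [← hdeg]; omega

/-- translation automorphism of `S[X]`. -/
noncomputable def shiftHom {n : ℕ} (b : Fin n → ℂ) :
    Polynomial (MvPolynomial (Fin n) ℂ) →+* Polynomial (MvPolynomial (Fin n) ℂ) :=
  Polynomial.eval₂RingHom (eval₂Hom (Polynomial.C.comp C)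
    (fun i => Polynomial.C (X i) + Polynomial.X * Polynomial.C (C (b i)))) Polynomial.X

lemma shiftHom_neg {n : ℕ} (b : Fin n → ℂ) (x) : shiftHom (-b) (shiftHom b x) = x := by
  have : (shiftHom (-b)).comp (shiftHom b) = RingHom.id _ := by
    apply Polynomial.ringHom_ext'
    · apply MvPolynomial.ringHom_ext
      · intro r; simp [shiftHom]
      · intro i; simp [shiftHom]; ring
    · simp [shiftHom]
  exact congrArg (fun g => g x) this

lemma generic_line {n : ℕ} {κ : Type*} [Fintype κ] (F : κ → MvPolynomial (Fin n) ℂ) (d : ℕ)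
    (hd0 : d ≠ 0) (hd : ∀ j, (F j).totalDegree ≤ d) (hd' : ∃ j, (F j).totalDegree = d)
    (hcop : ∀ r, (∀ j, r ∣ F j) → r.totalDegree = 0) :
    ∃ a b : Fin n → ℂ, GoodFam d
      (fun j => aeval (fun i => Polynomial.C (a i) + Polynomial.X * Polynomial.C (b i)) (F j)) := by
  obtain ⟨j0, hj0⟩ := hd'
  have hF0 : F j0 ≠ 0 := by rintro h; simp [h] at hj0; omega
  obtain ⟨b, hb⟩ : ∃ b, eval b (homogeneousComponent d (F j0)) ≠ 0 := by
    by_contra! h0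
    have h1 : homogeneousComponent d (F j0) = 0 := MvPolynomial.funext (by simpa using h0)
    obtain ⟨m, hm, hmd⟩ := Finset.exists_mem_eq_sup _ (support_nonempty.2 hF0)
      (fun m : Fin n →₀ ℕ => m.sum fun _ e => e)
    have h2 := congrArg (coeff m) h1
    rw [coeff_homogeneousComponent, if_pos, coeff_zero] at h2
    · exact mem_support_iff.1 hm h2
    · rw [← hj0]; exact hmd.symm
  let G : κ → Polynomial (MvPolynomial (Fin n) ℂ) := fun j => shiftHom b (Polynomial.C (F j))
  have hGF : ∀ j, shiftHom (-b) (G j) = Polynomial.C (F j) := fun j => shiftHom_neg b _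
  obtain ⟨R, hR, hR1⟩ := exists_C_mem_span G ⟨j0, fun h => hF0 (by
      have := hGF j0
      rw [h, map_zero] at this
      exact (Polynomial.C_eq_zero.1 this.symm))⟩ (by
    intro h hh
    have h1 : ∀ j, shiftHom (-b) h ∣ Polynomial.C (F j) := fun j => by
      rw [← hGF]; exact (shiftHom (-b)).map_dvd (hh j)
    have h2 : (shiftHom (-b) h).natDegree = 0 := by
      have := Polynomial.natDegree_le_of_dvd (h1 j0) (Polynomial.C_ne_zero.2 hF0)
      simpa using this
    rw [Polynomial.eq_C_of_natDegree_eq_zero h2] at h1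
    have h3 := hcop _ (fun j => by
      have := (Polynomial.C_dvd_iff_dvd_coeff _ _).1 (h1 j) 0
      simpa using this)
    rw [totalDegree_eq_zero_iff_eq_C] at h3
    have h4 := shiftHom_neg (-b) h
    rw [Polynomial.eq_C_of_natDegree_eq_zero h2, h3] at h4
    rw [← h4]
    simp [shiftHom])
  obtain ⟨a, ha⟩ : ∃ a, eval a R ≠ 0 := by
    by_contra! h0
    exact hR (MvPolynomial.funext (by simpa using h0))
  have hGa : ∀ j, (G j).map (eval a) =
      aeval (fun i => Polynomial.C (a i) + Polynomial.X * Polynomial.C (b i)) (F j) := by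
    intro j
    have : ((Polynomial.mapRingHom (eval a)).comp ((shiftHom b).comp Polynomial.C)) =
      ((aeval (fun i => Polynomial.C (a i) + Polynomial.X * Polynomial.C (b i)) :
        MvPolynomial (Fin n) ℂ →ₐ[ℂ] Polynomial ℂ) : MvPolynomial (Fin n) ℂ →+* Polynomial ℂ) := by
      apply MvPolynomial.ringHom_ext
      · intro r; simp [shiftHom]
      · intro i; simp [shiftHom]
    exact congrArg (fun g => g (F j)) this
  refine ⟨a, b, fun j => ?_, fun s => ?_, j0, ?_⟩
  · have := aeval_natDegree_le (n := 1) (F j) (hd j)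
      (fun i => Polynomial.C (a i) + Polynomial.X * Polynomial.C (b i)) (by
        intro i; compute_degree)
    simpa using this
  · by_contra! h0
    obtain ⟨c, hc⟩ := Ideal.mem_span_range_iff_exists_fun.1 hR1
    have := congrArg (fun P => (P.map (eval a)).eval s) hc
    simp only [Polynomial.map_sum, Polynomial.map_mul, hGa, Polynomial.eval_finsetSum,
      Polynomial.eval_mul, h0, Polynomial.map_C, Polynomial.eval_C] at this
    simp at this
    exact ha this.symm
  · rw [line_top_coeff _ _ (hd j0)]; exact hb

/-- Lucas-type coefficients. -/
def lucasC : ℕ → ℕ → ℕ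
  | 0, 0 => 2
  | 0, _ + 1 => 0
  | 1, 0 => 1
  | 1, _ + 1 => 0
  | m + 2, 0 => lucasC (m + 1) 0
  | m + 2, k + 1 => lucasC (m + 1) (k + 1) + lucasC m k

lemma lucasC_eq_zero : ∀ m k : ℕ, m < 2 * k → lucasC m k = 0
  | 0, 0, h => by omega
  | 0, _ + 1, _ => by simp [lucasC]
  | 1, 0, h => by omega
  | 1, _ + 1, _ => by simp [lucasC]
  | m + 2, 0, h => by omega
  | m + 2, k + 1, h => by
    rw [lucasC, lucasC_eq_zero (m + 1) (k + 1) (by omega), lucasC_eq_zero m k (by omega)]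

lemma lucasC_zero_right : ∀ m : ℕ, lucasC (m + 1) 0 = 1
  | 0 => by simp [lucasC]
  | m + 1 => by rw [lucasC, lucasC_zero_right m]

lemma lucas_sum (y : ℝ) : ∀ m K : ℕ, m ≤ 2 * K + 1 →
    ∑ k ∈ Finset.range (K + 1), (lucasC m k : ℝ) * (1 - y) ^ (m - 2 * k) * y ^ k
      = 1 + (-y) ^ m
  | 0, K, _ => by
    rw [Finset.sum_range_succ', Finset.sum_eq_zero]
    · simp [lucasC]; norm_num
    · intro k _; simp [lucasC]
  | 1, K, _ => by
    rw [Finset.sum_range_succ', Finset.sum_eq_zero]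
    · simp [lucasC]; ring
    · intro k _; simp [lucasC]
  | m + 2, 0, h => by omega
  | m + 2, K + 1, h => by
    have h1 := lucas_sum y (m + 1) (K + 1) (by omega)
    have h2 := lucas_sum y m K (by omega)
    rw [Finset.sum_range_succ'] at h1 ⊢
    have e : ∀ k ∈ Finset.range (K + 1),
        (lucasC (m + 2) (k + 1) : ℝ) * (1 - y) ^ (m + 2 - 2 * (k + 1)) * y ^ (k + 1)
        = (1 - y) * ((lucasC (m + 1) (k + 1) : ℝ) * (1 - y) ^ (m + 1 - 2 * (k + 1)) * y ^ (k + 1))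
          + y * ((lucasC m k : ℝ) * (1 - y) ^ (m - 2 * k) * y ^ k) := by
      intro k _
      rw [lucasC]
      have e1 : m + 2 - 2 * (k + 1) = m - 2 * k := by omega
      rw [e1]
      by_cases hk : m + 1 < 2 * (k + 1)
      · rw [lucasC_eq_zero _ _ hk]; push_cast; ring
      · have e2 : m - 2 * k = (m + 1 - 2 * (k + 1)) + 1 := by omega
        rw [e2]; push_cast; ring
    rw [Finset.sum_congr rfl e, Finset.sum_add_distrib, ← Finset.mul_sum, ← Finset.mul_sum, h2]
    rw [lucasC]
    have e3 : (lucasC (m + 1) 0 : ℝ) * (1 - y) ^ (m + 2 - 2 * 0) * y ^ 0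
      = (1 - y) * ((lucasC (m + 1) 0 : ℝ) * (1 - y) ^ (m + 1 - 2 * 0) * y ^ 0) := by
      simp only [mul_zero, Nat.sub_zero, pow_zero]; ring
    rw [e3]
    have : (1 - y) * (∑ k ∈ Finset.range (K + 1), (lucasC (m + 1) (k + 1) : ℝ) *
        (1 - y) ^ (m + 1 - 2 * (k + 1)) * y ^ (k + 1)) =
        (1 - y) * (1 + (-y) ^ (m + 1)) - 
        (1 - y) * ((lucasC (m + 1) 0 : ℝ) * (1 - y) ^ (m + 1 - 2 * 0) * y ^ 0) := by
      rw [← h1]; ring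
    rw [this]; ring

/-- The monomial map. -/
noncomputable def gmap (ν : ℕ) : Fin (ν + 2) → MvPolynomial (Fin 2) ℂ :=
  Fin.snoc (α := fun _ => MvPolynomial (Fin 2) ℂ) (fun k : Fin (ν + 1) =>
    C ((Real.sqrt (lucasC (2 * ν + 1) k) : ℝ) : ℂ) * X 0 ^ (2 * ν + 1 - 2 * (k : ℕ)) * X 1 ^ (k : ℕ))
    (X 1 ^ (2 * ν + 1))

lemma gmap_norm (ν : ℕ) (w : Fin 2 → ℂ) (hw : ‖w 0‖ ^ 2 + ‖w 1‖ ^ 2 = 1) :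
    ∑ k, ‖eval w (gmap ν k)‖ ^ 2 = 1 := by
  rw [Fin.sum_univ_castSucc]
  simp only [gmap, Fin.snoc_castSucc, Fin.snoc_last, map_mul, map_pow, eval_C, eval_X, norm_mul,
    norm_pow, Complex.norm_real, Real.norm_eq_abs, mul_pow, sq_abs]
  have h := lucas_sum (‖w 1‖ ^ 2) (2 * ν + 1) ν (by omega)
  rw [Finset.sum_range] at h
  have hx : 1 - ‖w 1‖ ^ 2 = ‖w 0‖ ^ 2 := by linarith
  rw [hx] at h
  have e : ∀ k : Fin (ν + 1), Real.sqrt (lucasC (2 * ν + 1) k) ^ 2 *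
      (‖w 0‖ ^ (2 * ν + 1 - 2 * (k : ℕ))) ^ 2 * (‖w 1‖ ^ (k : ℕ)) ^ 2 =
      (lucasC (2 * ν + 1) k : ℝ) * (‖w 0‖ ^ 2) ^ (2 * ν + 1 - 2 * (k : ℕ)) * 
        (‖w 1‖ ^ 2) ^ (k : ℕ) := by
    intro k
    rw [Real.sq_sqrt (by positivity)]
    ring
  simp_rw [e]
  rw [h, Odd.neg_pow ⟨ν, rfl⟩]
  ring

/-- restriction to an affine line -/
noncomputable def lineP {n : ℕ} (z v : Fin n → ℂ) : MvPolynomial (Fin n) ℂ →ₐ[ℂ] Polynomial ℂ :=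
  aeval (fun i => Polynomial.C (z i) + Polynomial.X * Polynomial.C (v i))

lemma lineP_X {n : ℕ} (z v : Fin n → ℂ) (i) :
    lineP z v (X i) = Polynomial.C (z i) + Polynomial.X * Polynomial.C (v i) := by
  simp [lineP]

lemma lineP_natDegree {n : ℕ} (z v : Fin n → ℂ) (F) (d) (h : totalDegree F ≤ d) :
    (lineP z v F).natDegree ≤ d := by
  have := aeval_natDegree_le (n := 1) F h
      (fun i => Polynomial.C (z i) + Polynomial.X * Polynomial.C (v i)) (by
        intro i; compute_degree)
  simpa [lineP] using this

lemma lineP_eval {n : ℕ} (z v : Fin n → ℂ) (F) (t : ℂ) :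
    (lineP z v F).eval t = eval (fun i => z i + t * v i) F := by
  have : (Polynomial.evalRingHom t).comp (lineP z v : MvPolynomial (Fin n) ℂ →+* Polynomial ℂ)
    = eval (fun i => z i + t * v i) := by
    apply MvPolynomial.ringHom_ext
    · intro r; simp [lineP]
    · intro i; simp [lineP]; ring
  exact congrArg (fun g => g F) this

lemma gmap_totalDegree (ν : ℕ) (k) : (gmap ν k).totalDegree ≤ 2 * ν + 1 := by
  induction k using Fin.lastCases with
  | last => simp only [gmap, Fin.snoc_last]; exact (totalDegree_X_pow _ _).le
  | cast k =>
    simp only [gmap, Fin.snoc_castSucc]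
    refine (totalDegree_mul _ _).trans ?_
    refine (add_le_add (totalDegree_mul _ _) le_rfl).trans ?_
    simp only [totalDegree_C, totalDegree_X_pow]
    have := k.2
    omega

lemma gmap_zero (ν : ℕ) : lineP ![1, 0] ![0, 1] (gmap ν 0) = 1 := by
  have : gmap ν 0 = gmap ν (Fin.castSucc 0) := rfl
  rw [this]
  simp only [gmap, Fin.snoc_castSucc]
  simp [lineP, lucasC_zero_right]

lemma gmap_last (ν : ℕ) : lineP ![1, 0] ![0, 1] (gmap ν (Fin.last _)) =
    Polynomial.X ^ (2 * ν + 1) := by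
  simp only [gmap, Fin.snoc_last]
  simp [lineP]

lemma goodFam_expand {κ : Type*} {d m : ℕ} (hm : m ≠ 0) {f : κ → Polynomial ℂ}
    (h : GoodFam d f) : GoodFam (d * m) (fun j => Polynomial.expand ℂ m (f j)) := by
  obtain ⟨h1, h2, j, hj⟩ := h
  refine ⟨fun j => ?_, fun s => ?_, j, ?_⟩
  · rw [Polynomial.natDegree_expand]; exact Nat.mul_le_mul_right _ (h1 j)
  · obtain ⟨j, hj⟩ := h2 (s ^ m)
    exact ⟨j, by rwa [Polynomial.expand_eval]⟩
  · rwa [Polynomial.coeff_expand_mul (Nat.pos_of_ne_zero hm)]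

/-- pull back by `A ∘ g` -/
noncomputable def pullG {ν : ℕ} (A : Matrix (Fin (ν + 2)) (Fin (ν + 2)) ℂ) :
    MvPolynomial (Fin (ν + 2)) ℂ →ₐ[ℂ] MvPolynomial (Fin 2) ℂ :=
  aeval (fun i => ∑ k, C (A i k) * gmap ν k)

lemma lineP_pullG {ν : ℕ} (A : Matrix (Fin (ν + 2)) (Fin (ν + 2)) ℂ) (z v) (F) :
    lineP z v (pullG A F) =
      aeval (fun i => ∑ k, Polynomial.C (A i k) * lineP z v (gmap ν k)) F := by
  have : (lineP z v).comp (pullG A) = 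
      aeval (fun i => ∑ k, Polynomial.C (A i k) * lineP z v (gmap ν k)) := by
    apply MvPolynomial.algHom_ext
    intro i
    simp only [pullG, AlgHom.comp_apply, aeval_X, map_sum, map_mul]
    refine Finset.sum_congr rfl fun k _ => ?_
    congr 1
    simp [lineP]
  exact congrArg (fun g => g F) this

lemma lineP_pullG_natDegree {ν : ℕ} (A : Matrix (Fin (ν + 2)) (Fin (ν + 2)) ℂ) (z v) (F)
    (d : ℕ) (hF : totalDegree F ≤ d) :
    (lineP z v (pullG A F)).natDegree ≤ d * (2 * ν + 1) := by
  rw [lineP_pullG]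
  apply aeval_natDegree_le _ hF
  intro i
  refine Polynomial.natDegree_sum_le_of_forall_le _ _ fun k _ => ?_
  exact (Polynomial.natDegree_C_mul_le _ _).trans (lineP_natDegree _ _ _ _ (gmap_totalDegree ν k))

lemma exists_good_unitary {ν : ℕ} {κ : Type*} [Fintype κ]
    (F : κ → MvPolynomial (Fin (ν + 2)) ℂ) (d : ℕ)
    (hd0 : d ≠ 0) (hd : ∀ j, (F j).totalDegree ≤ d) (hd' : ∃ j, (F j).totalDegree = d)
    (hcop : ∀ r, (∀ j, r ∣ F j) → r.totalDegree = 0) :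
    ∃ U : Matrix (Fin (ν + 2)) (Fin (ν + 2)) ℂ, U.conjTranspose * U = 1 ∧
      GoodFam (d * (2 * ν + 1)) (fun j => lineP ![1, 0] ![0, 1] (pullG U (F j))) := by
  obtain ⟨a, b, hab⟩ := generic_line F d hd0 hd hd' hcop
  have hab2 := goodFam_expand (m := 2 * ν + 1) (by omega) hab
  let A0 : Matrix (Fin (ν + 2)) (Fin (ν + 2)) ℂ := fun i k =>
    if k = 0 then a i else if k = Fin.last _ then b i else 0
  have hA0 : ∀ j, lineP ![1, 0] ![0, 1] (pullG A0 (F j)) = Polynomial.expand ℂ (2 * ν + 1)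
      (aeval (fun i => Polynomial.C (a i) + Polynomial.X * Polynomial.C (b i)) (F j)) := by
    intro j
    rw [lineP_pullG]
    have : aeval (fun i => ∑ k, Polynomial.C (A0 i k) * lineP ![1, 0] ![0, 1] (gmap ν k)) =
      (Polynomial.expand ℂ (2 * ν + 1)).comp
        (aeval (fun i => Polynomial.C (a i) + Polynomial.X * Polynomial.C (b i))) := by
      apply MvPolynomial.algHom_ext
      intro i
      simp only [AlgHom.comp_apply, aeval_X]
      have h0l : (Fin.last (ν + 1)) ≠ 0 := by
        intro h; have := congrArg Fin.val h; simp at this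
      rw [Finset.sum_eq_add (0 : Fin (ν + 2)) (Fin.last _) h0l.symm]
      · rw [gmap_zero, gmap_last]
        have e1 : A0 i 0 = a i := by simp [A0]
        have e2 : A0 i (Fin.last _) = b i := by simp [A0]
        rw [e1, e2]
        simp only [map_add, map_mul, Polynomial.expand_C, Polynomial.expand_X]
        ring
      · intro k _ hk
        simp [A0, hk.1, hk.2]
      · simp
      · simp
    exact congrArg (fun g => g (F j)) this
  simp_rw [← hA0] at hab2
  obtain ⟨j, e, hres⟩ := good_to_res hab2
  let 𝓛 : κ → Polynomial (MvPolynomial (Fin (ν + 2) × Fin (ν + 2)) ℂ) := fun j =>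
    eval₂Hom (Polynomial.C.comp C) (fun i => ∑ k, Polynomial.C (X (i, k)) *
      (lineP ![1, 0] ![0, 1] (gmap ν k)).map C) (F j)
  have h𝓛 : ∀ (A : Matrix (Fin (ν + 2)) (Fin (ν + 2)) ℂ) (j),
      (𝓛 j).map (eval (fun ij => A ij.1 ij.2)) = lineP ![1, 0] ![0, 1] (pullG A (F j)) := by
    intro A j
    rw [lineP_pullG]
    have : (Polynomial.mapRingHom (eval (fun ij => A ij.1 ij.2))).comp
      (eval₂Hom (Polynomial.C.comp C) (fun i => ∑ k, Polynomial.C (X (i, k)) *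
      (lineP ![1, 0] ![0, 1] (gmap ν k)).map C)) =
      ((aeval (fun i => ∑ k, Polynomial.C (A i k) * lineP ![1, 0] ![0, 1] (gmap ν k)) :
        MvPolynomial (Fin (ν + 2)) ℂ →ₐ[ℂ] Polynomial ℂ) :
        MvPolynomial (Fin (ν + 2)) ℂ →+* Polynomial ℂ) := by
      have hid : (eval (fun ij : Fin (ν + 2) × Fin (ν + 2) => A ij.1 ij.2)).comp C
        = RingHom.id ℂ := by ext x <;> simp
      apply MvPolynomial.ringHom_ext
      · intro r; simp
      · intro i; simp [Polynomial.map_map, hid]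
    exact congrArg (fun g => g (F j)) this
  let R := Polynomial.resultant (𝓛 j) (∑ i, Polynomial.C (C (e i)) * 𝓛 i)
    (d * (2 * ν + 1)) (d * (2 * ν + 1))
  have hR : ∀ A : Matrix (Fin (ν + 2)) (Fin (ν + 2)) ℂ,
      eval (fun ij => A ij.1 ij.2) R = Polynomial.resultant
        (lineP ![1, 0] ![0, 1] (pullG A (F j)))
        (∑ i, Polynomial.C (e i) * lineP ![1, 0] ![0, 1] (pullG A (F i)))
        (d * (2 * ν + 1)) (d * (2 * ν + 1)) := by
    intro A
    rw [← Polynomial.resultant_map_map, h𝓛, Polynomial.map_sum]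
    congr 1
    refine Finset.sum_congr rfl fun i _ => ?_
    rw [Polynomial.map_mul, Polynomial.map_C, eval_C, h𝓛]
  have hR0 : R ≠ 0 := by
    intro h
    apply hres
    rw [← hR, h, map_zero]
  obtain ⟨U, hU, hU1⟩ := exists_unitary_eval_ne_zero _ R hR0
  refine ⟨U, hU, ?_⟩
  rw [hR] at hU1
  exact res_to_good (by positivity) (fun j => lineP_pullG_natDegree _ _ _ _ _ (hd j)) j e hU1

lemma pullG_eval {ν : ℕ} (A : Matrix (Fin (ν + 2)) (Fin (ν + 2)) ℂ) (F) (w : Fin 2 → ℂ) :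
    eval w (pullG A F) = eval (A.mulVec (fun k => eval w (gmap ν k))) F := by
  have : (eval w).comp (pullG A : MvPolynomial (Fin (ν + 2)) ℂ →+* MvPolynomial (Fin 2) ℂ)
    = eval (A.mulVec (fun k => eval w (gmap ν k))) := by
    apply MvPolynomial.ringHom_ext
    · intro r; simp [pullG]
    · intro i; simp [pullG, Matrix.mulVec, dotProduct]
  exact congrArg (fun g => g F) this

lemma unitary_norm {n : ℕ} (U : Matrix (Fin n) (Fin n) ℂ) (hU : U.conjTranspose * U = 1)
    (x : Fin n → ℂ) : ∑ i, ‖U.mulVec x i‖ ^ 2 = ∑ i, ‖x i‖ ^ 2 := by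
  have h : star (U.mulVec x) ⬝ᵥ (U.mulVec x) = star x ⬝ᵥ x := by
    rw [Matrix.star_mulVec, Matrix.dotProduct_mulVec, Matrix.vecMul_vecMul, hU, Matrix.vecMul_one]
  have key : ∀ y : Fin n → ℂ, star y ⬝ᵥ y = ((∑ i, ‖y i‖ ^ 2 : ℝ) : ℂ) := by
    intro y
    simp only [dotProduct, Pi.star_apply, Complex.ofReal_sum]
    refine Finset.sum_congr rfl fun i _ => ?_
    simpa using Complex.conj_mul' (y i)
  rw [key, key] at h
  exact_mod_cast h

/-- rotated conjugate vector -/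
def Jv (ω : Fin 2 → ℂ) : Fin 2 → ℂ := ![-(ω 1), ω 0]

/-- universal line restriction -/
noncomputable def univLine :
    MvPolynomial (Fin 2) ℂ →+* Polynomial (MvPolynomial (Fin 2 ⊕ Fin 2) ℂ) :=
  eval₂Hom (Polynomial.C.comp C) (fun i => Polynomial.C (X (Sum.inl i)) +
    Polynomial.X * Polynomial.C ((![-X (Sum.inr 1), X (Sum.inr 0)] : Fin 2 → _) i))

lemma univLine_map (z ω : Fin 2 → ℂ) (G) :
    (univLine G).map (eval (Sum.elim z ω)) = lineP z (Jv ω) G := by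
  have : (Polynomial.mapRingHom (eval (Sum.elim z ω))).comp univLine =
      (lineP z (Jv ω) : MvPolynomial (Fin 2) ℂ →+* Polynomial ℂ) := by
    apply MvPolynomial.ringHom_ext
    · intro r; simp [univLine, lineP]
    · intro i; fin_cases i <;> simp [univLine, lineP, Jv]
  exact congrArg (fun g => g G) this

lemma lineP_shift {n : ℕ} (z v : Fin n → ℂ) (t : ℂ) (F) :
    lineP (fun i => z i + t * v i) v F = Polynomial.taylor t (lineP z v F) := by
  have : lineP (fun i => z i + t * v i) v = (Polynomial.taylorAlgHom t).comp (lineP z v) := by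
    apply MvPolynomial.algHom_ext
    intro i
    simp [lineP, Polynomial.taylor_apply]
    ring
  have := congrArg (fun g => g F) this
  simpa using this

lemma goodFam_taylor {κ : Type*} {D : ℕ} {f : κ → Polynomial ℂ} (h : GoodFam D f) (t : ℂ) :
    GoodFam D (fun j => Polynomial.taylor t (f j)) := by
  obtain ⟨h1, h2, j, hj⟩ := h
  refine ⟨fun j => ?_, fun s => ?_, j, ?_⟩
  · rw [Polynomial.natDegree_taylor]; exact h1 j
  · obtain ⟨j, hj⟩ := h2 (s + t)
    exact ⟨j, by rwa [Polynomial.taylor_eval]⟩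
  · have hdeg : (f j).natDegree = D :=
      le_antisymm (h1 j) (Polynomial.le_natDegree_of_ne_zero hj)
    have hd2 : (Polynomial.taylor t (f j)).natDegree = D := by
      rw [Polynomial.natDegree_taylor, hdeg]
    have h0 : Polynomial.taylor t (f j) ≠ 0 := by
      intro h0
      rw [Polynomial.taylor_eq_zero] at h0
      simp [h0] at hj
    rw [← Polynomial.leadingCoeff_ne_zero, Polynomial.leadingCoeff, hd2] at h0
    exact h0

lemma move_to_sphere {κ : Type*} [Fintype κ] [DecidableEq κ] (G : κ → MvPolynomial (Fin 2) ℂ)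
    (D : ℕ) (hD : D ≠ 0) (hdeg : ∀ z v j, (lineP z v (G j)).natDegree ≤ D) (m : ℕ)
    (z ω : Fin 2 → ℂ) (h : z 0 * ω 0 + z 1 * ω 1 = 1)
    (hgood : GoodFam D (fun j => lineP z (Jv ω) (G j)))
    (hli : LinearIndependent ℂ
      (fun (k : Fin m) (j : κ) => (lineP z (Jv ω) (G j)).coeff k)) :
    ∃ w : Fin 2 → ℂ, w 0 * star (w 0) + w 1 * star (w 1) = 1 ∧
      GoodFam D (fun j => lineP w (Jv fun i => star (w i)) (G j)) ∧
      LinearIndependent ℂ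
        (fun (k : Fin m) (j : κ) => (lineP w (Jv fun i => star (w i)) (G j)).coeff k) := by
  obtain ⟨j, e, hres⟩ := good_to_res hgood
  obtain ⟨Λ, hΛ⟩ := (li_iff_det _).1 hli
  let R := Polynomial.resultant (univLine (G j)) (∑ i, Polynomial.C (C (e i)) * univLine (G i)) D D
  let Q := (Matrix.of fun (k i : Fin m) => 
    ∑ j, C (Λ i j) * (univLine (G j)).coeff k).det
  have hR : ∀ z ω, eval (Sum.elim z ω) R = Polynomial.resultant (lineP z (Jv ω) (G j))
      (∑ i, Polynomial.C (e i) * lineP z (Jv ω) (G i)) D D := by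
    intro z ω
    rw [← Polynomial.resultant_map_map, univLine_map, Polynomial.map_sum]
    congr 1
    refine Finset.sum_congr rfl fun i _ => ?_
    rw [Polynomial.map_mul, Polynomial.map_C, eval_C, univLine_map]
  have hQ : ∀ z ω, eval (Sum.elim z ω) Q = (Matrix.of fun (k i : Fin m) => 
      ∑ j, Λ i j * (lineP z (Jv ω) (G j)).coeff k).det := by
    intro z ω
    rw [RingHom.map_det]
    congr 1
    ext k i
    simp only [RingHom.mapMatrix_apply, Matrix.map_apply, Matrix.of_apply, map_sum, map_mul, eval_C]
    refine Finset.sum_congr rfl fun j _ => ?_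
    rw [← univLine_map, Polynomial.coeff_map]
  obtain ⟨w, hw, hw2⟩ := sphere_dense (R * Q) z ω h (by
    rw [map_mul, hR, hQ]; exact mul_ne_zero hres hΛ)
  rw [map_mul, hR, hQ] at hw2
  exact ⟨w, hw, res_to_good hD (fun j => hdeg _ _ j) j e (left_ne_zero_of_mul hw2),
    (li_iff_det _).2 ⟨Λ, right_ne_zero_of_mul hw2⟩⟩

lemma exists_saturated {κ : Type*} [Fintype κ] [DecidableEq κ] (G : κ → MvPolynomial (Fin 2) ℂ)
    (D : ℕ) (hD : D ≠ 0) (hdeg : ∀ z v j, (lineP z v (G j)).natDegree ≤ D)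
    (hgood : GoodFam D (fun j => lineP ![1, 0] ![0, 1] (G j))) :
    ∃ (r : ℕ) (w : Fin 2 → ℂ), w 0 * star (w 0) + w 1 * star (w 1) = 1 ∧
      GoodFam D (fun j => lineP w (Jv fun i => star (w i)) (G j)) ∧
      LinearIndependent ℂ
        (fun (k : Fin (r + 1)) (j : κ) => (lineP w (Jv fun i => star (w i)) (G j)).coeff k) ∧
      ∀ K : ℕ, (fun j => (lineP w (Jv fun i => star (w i)) (G j)).coeff K) ∈ 
        Submodule.span ℂ (Set.range (fun (k : Fin (r + 1)) (j : κ) =>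
          (lineP w (Jv fun i => star (w i)) (G j)).coeff k)) := by
  by_contra! hcon
  have hP : ∀ r : ℕ, ∃ w : Fin 2 → ℂ, w 0 * star (w 0) + w 1 * star (w 1) = 1 ∧
      GoodFam D (fun j => lineP w (Jv fun i => star (w i)) (G j)) ∧
      LinearIndependent ℂ
        (fun (k : Fin (r + 1)) (j : κ) => (lineP w (Jv fun i => star (w i)) (G j)).coeff k) := by
    intro r
    induction r with
    | zero =>
      have hJ : (Jv fun i => star ((![1, 0] : Fin 2 → ℂ) i)) = ![0, 1] := by
        ext i; fin_cases i <;> simp [Jv]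
      refine ⟨![1, 0], by simp, ?_, ?_⟩
      · rw [hJ]; exact hgood
      · rw [hJ]
        change LinearIndependent ℂ (fun (k : Fin 1) (j : κ) =>
          (lineP ![1, 0] ![0, 1] (G j)).coeff k)
        rw [linearIndependent_unique_iff]
        intro h0
        obtain ⟨j, hj⟩ := hgood.2.1 0
        apply hj
        rw [← Polynomial.coeff_zero_eq_eval_zero]
        simpa using congrFun h0 j
    | succ r ih =>
      obtain ⟨w, hw, hg, hli⟩ := ih
      obtain ⟨K, hK⟩ := hcon r w hw hg hli
      obtain ⟨t, ht⟩ := wronsk _ r hli ⟨K, hK⟩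
      set ω : Fin 2 → ℂ := fun i => star (w i) with hω
      apply move_to_sphere G D hD hdeg (r + 1 + 1) (fun i => w i + t * Jv ω i) ω
      · simp only [Jv, Matrix.cons_val_zero, Matrix.cons_val_one]
        rw [← hw]; ring
      · simp_rw [lineP_shift]
        exact goodFam_taylor hg t
      · simp_rw [lineP_shift]
        exact ht
  obtain ⟨w, -, -, hli⟩ := hP (Fintype.card κ)
  have := hli.fintype_card_le_finrank
  simp at this

/-- signature -/
def eps {N : ℕ} : Option (Fin N) → ℂ
  | none => -1
  | some _ => 1

lemma polarize {N : ℕ} (G : Option (Fin N) → MvPolynomial (Fin 2) ℂ)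
    (hG : ∀ w : Fin 2 → ℂ, w 0 * star (w 0) + w 1 * star (w 1) = 1 →
      ∑ j, eps j * eval w (G j) * star (eval w (G j)) = 0)
    (z ω : Fin 2 → ℂ) (h : z 0 * ω 0 + z 1 * ω 1 = 1) :
    ∑ j, eps j * eval z (G j) * eval ω (map (starRingEnd ℂ) (G j)) = 0 := by
  by_contra hne
  let Φ : MvPolynomial (Fin 2 ⊕ Fin 2) ℂ := ∑ j, C (eps j) * rename Sum.inl (G j) *
    rename Sum.inr (map (starRingEnd ℂ) (G j))
  have hΦ : ∀ z ω, eval (Sum.elim z ω) Φ =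
      ∑ j, eps j * eval z (G j) * eval ω (map (starRingEnd ℂ) (G j)) := by
    intro z ω
    simp only [Φ, map_sum, map_mul, eval_C, eval_rename]
    rfl
  obtain ⟨w, hw, hw2⟩ := sphere_dense Φ z ω h (by rw [hΦ]; exact hne)
  apply hw2
  rw [hΦ, ← hG w hw]
  refine Finset.sum_congr rfl fun j _ => ?_
  congr 1
  rw [eval_map]
  have := MvPolynomial.eval₂_comp_left (starRingEnd ℂ) (RingHom.id ℂ) w (G j)
  simp only [RingHom.comp_id] at this
  exact this.symm

/-- two-parameter restriction -/
noncomputable def twoP (zb vb : Fin 2 → ℂ) :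
    MvPolynomial (Fin 2) ℂ →+* Polynomial (Polynomial ℂ) :=
  eval₂Hom (Polynomial.C.comp Polynomial.C) (fun i => Polynomial.C (Polynomial.C (zb i)) +
    Polynomial.X * Polynomial.C (Polynomial.C (vb i) - Polynomial.X * Polynomial.C (zb i)))

lemma twoP_map (zb vb : Fin 2 → ℂ) (t : ℂ) (F) :
    (twoP zb vb F).map (Polynomial.evalRingHom t) =
      lineP zb (fun i => vb i - t * zb i) F := by
  have : (Polynomial.mapRingHom (Polynomial.evalRingHom t)).comp (twoP zb vb) =
      (lineP zb (fun i => vb i - t * zb i) : MvPolynomial (Fin 2) ℂ →+* Polynomial ℂ) := by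
    apply MvPolynomial.ringHom_ext
    · intro r; simp [twoP, lineP]
    · intro i; simp [twoP, lineP, mul_comm t]
  exact congrArg (fun g => g F) this

lemma twoP_natDegree (zb vb : Fin 2 → ℂ) (F) (k : ℕ) :
    ((twoP zb vb F).coeff k).natDegree ≤ k := by
  induction F using MvPolynomial.induction_on generalizing k with
  | C a =>
    simp only [twoP, eval₂Hom_C, RingHom.comp_apply, Polynomial.coeff_C]
    split_ifs <;> simp
  | add p q hp hq =>
    rw [map_add, Polynomial.coeff_add]
    exact (Polynomial.natDegree_add_le _ _).trans (max_le (hp k) (hq k))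
  | mul_X p i hp =>
    rw [map_mul]
    simp only [twoP, eval₂Hom_X', mul_add, Polynomial.coeff_add]
    refine (Polynomial.natDegree_add_le _ _).trans (max_le ?_ ?_)
    · rw [Polynomial.coeff_mul_C]
      exact (Polynomial.natDegree_mul_C_le _ _).trans (hp k)
    · rw [← mul_assoc, Polynomial.coeff_mul_C]
      cases k with
      | zero => simp
      | succ k =>
        rw [Polynomial.coeff_mul_X]
        refine Polynomial.natDegree_mul_le.trans (add_le_add (hp k) ?_)
        compute_degree

lemma lineP_star {n : ℕ} (z v : Fin n → ℂ) (F) :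
    lineP (fun i => star (z i)) (fun i => star (v i)) (map (starRingEnd ℂ) F) =
      (lineP z v F).map (starRingEnd ℂ) := by
  have : ((lineP (fun i => star (z i)) (fun i => star (v i)) :
      MvPolynomial (Fin n) ℂ →+* Polynomial ℂ)).comp (map (starRingEnd ℂ)) =
      (Polynomial.mapRingHom (starRingEnd ℂ)).comp
        (lineP z v : MvPolynomial (Fin n) ℂ →+* Polynomial ℂ) := by
    apply MvPolynomial.ringHom_ext
    · intro r; simp [lineP]
    · intro i; simp [lineP]
  exact congrArg (fun g => g F) this

/-- A null vector orthogonal to a null vector with nonzero last coordinate is proportional. -/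
lemma null_prop {N : ℕ} (u x : Option (Fin N) → ℂ) (hu : u none ≠ 0)
    (huu : ∑ j, eps j * u j * star (u j) = 0) (hxu : ∑ j, eps j * x j * star (u j) = 0)
    (hxx : ∑ j, eps j * x j * star (x j) = 0) : ∃ l : ℂ, x = l • u := by
  refine ⟨x none / u none, ?_⟩
  set l := x none / u none with hl
  have hux : ∑ j, eps j * u j * star (x j) = 0 := by
    have := congrArg star hxu
    rw [star_sum, star_zero] at this
    rw [← this]
    refine Finset.sum_congr rfl fun j _ => ?_
    cases j <;> simp [eps] <;> ring
  have hyy : ∑ j, eps j * (x j - l * u j) * star (x j - l * u j) = 0 := by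
    have : ∀ j, eps j * (x j - l * u j) * star (x j - l * u j) =
        eps j * x j * star (x j) - star l * (eps j * x j * star (u j))
        - l * (eps j * u j * star (x j)) + l * star l * (eps j * u j * star (u j)) := by
      intro j
      rw [star_sub, star_mul']
      ring
    simp_rw [this]
    rw [Finset.sum_add_distrib, Finset.sum_sub_distrib, Finset.sum_sub_distrib,
      ← Finset.mul_sum, ← Finset.mul_sum, ← Finset.mul_sum, huu, hxu, hxx, hux]
    simp
  have hn : x none - l * u none = 0 := by rw [hl]; field_simp; ring
  rw [Fintype.sum_option, hn] at hyy
  simp only [eps, one_mul, mul_zero, zero_mul, zero_add] at hyy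
  have hre : ∑ i : Fin N, ‖x (some i) - l * u (some i)‖ ^ 2 = 0 := by
    have h2 : ((∑ i : Fin N, ‖x (some i) - l * u (some i)‖ ^ 2 : ℝ) : ℂ) = 0 := by
      rw [← hyy, Complex.ofReal_sum]
      refine Finset.sum_congr rfl fun i _ => ?_
      rw [Complex.ofReal_pow, ← Complex.mul_conj']
      rfl
    exact_mod_cast h2
  rw [Finset.sum_eq_zero_iff_of_nonneg (fun i _ => by positivity)] at hre
  ext j
  cases j with
  | none => simpa [sub_eq_zero] using hn
  | some i =>
    have := hre i (Finset.mem_univ _)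
    simpa [sub_eq_zero] using this

lemma two_dim_bound {N : ℕ} (G : Option (Fin N) → MvPolynomial (Fin 2) ℂ)
    (hG : ∀ w : Fin 2 → ℂ, w 0 * star (w 0) + w 1 * star (w 1) = 1 →
      ∑ j, eps j * eval w (G j) * star (eval w (G j)) = 0)
    (hq : ∀ w : Fin 2 → ℂ, w 0 * star (w 0) + w 1 * star (w 1) = 1 → eval w (G none) ≠ 0)
    (D : ℕ) (hD : D ≠ 0) (hdeg : ∀ z v j, (lineP z v (G j)).natDegree ≤ D)
    (hgood : GoodFam D (fun j => lineP ![1, 0] ![0, 1] (G j))) :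
    ∃ r : ℕ, r + 1 ≤ N ∧ D ≤ r * (r + 1) / 2 := by
  obtain ⟨r, z, hz, hg, hli, hspan⟩ := exists_saturated G D hD hdeg hgood
  refine ⟨r, ?_⟩
  set zb : Fin 2 → ℂ := fun i => star (z i) with hzb
  set v := Jv zb with hv
  set vb : Fin 2 → ℂ := fun i => star (v i) with hvb
  have hvb0 : vb 0 = - z 1 := by simp [hvb, hv, Jv, hzb]
  have hvb1 : vb 1 = z 0 := by simp [hvb, hv, Jv, hzb]
  have hv0 : v 0 = - zb 1 := by simp [hv, Jv]
  have hv1 : v 1 = zb 0 := by simp [hv, Jv]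
  have hz' : z 0 * zb 0 + z 1 * zb 1 = 1 := hz
  set f : Option (Fin N) → Polynomial ℂ := fun j => lineP z v (G j) with hf
  set fv : ℕ → Option (Fin N) → ℂ := fun K j => (f j).coeff K with hfv
  let M : Option (Fin N) → Polynomial (Polynomial ℂ) :=
    fun j => twoP zb vb (map (starRingEnd ℂ) (G j))
  -- the fundamental relation
  have hrel : ∀ k : ℕ, ∑ j, Polynomial.C (eps j) * f j * (M j).coeff k = 0 := by
    intro k
    apply Polynomial.funext
    intro t
    have h1 : ∑ j, Polynomial.C (eps j * (f j).eval t) *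
        lineP zb (fun i => vb i - t * zb i) (map (starRingEnd ℂ) (G j)) = 0 := by
      apply Polynomial.funext
      intro s
      have := polarize G hG (fun i => z i + t * v i) (fun i => zb i + s * (vb i - t * zb i)) (by
        rw [hvb0, hvb1, hv0, hv1]
        linear_combination hz')
      simp only [Polynomial.eval_finsetSum, Polynomial.eval_mul, Polynomial.eval_C, lineP_eval,
        hf, Polynomial.eval_zero]
      exact this
    have h2 := congrArg (fun P => Polynomial.coeff P k) h1
    simp only [Polynomial.finsetSum_coeff, Polynomial.coeff_C_mul, Polynomial.coeff_zero] at h2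
    simp only [Polynomial.eval_finsetSum, Polynomial.eval_mul, Polynomial.eval_C,
      Polynomial.eval_zero]
    rw [← h2]
    refine Finset.sum_congr rfl fun j _ => ?_
    rw [← twoP_map, Polynomial.coeff_map]
    rfl
  have hM0 : ∀ j k, ((M j).coeff k).eval 0 = star (fv k j) := by
    intro j k
    have h1 := twoP_map zb vb 0 (map (starRingEnd ℂ) (G j))
    have h2 : (fun i => vb i - 0 * zb i) = fun i => star (v i) := by
      ext i; simp [hvb]
    rw [h2, hzb, lineP_star] at h1
    have h3 := congrArg (fun P => Polynomial.coeff P k) h1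
    simp only [Polynomial.coeff_map] at h3
    exact h3
  have hM00 : ∀ j, (M j).coeff 0 = Polynomial.C (star (fv 0 j)) := by
    intro j
    have := twoP_natDegree zb vb (map (starRingEnd ℂ) (G j)) 0
    rw [← hM0 j 0, ← Polynomial.coeff_zero_eq_eval_zero]
    exact Polynomial.eq_C_of_natDegree_le_zero this
  have horth : ∀ K, ∑ j, eps j * fv K j * star (fv 0 j) = 0 := by
    intro K
    have h1 := congrArg (fun P => Polynomial.coeff P K) (hrel 0)
    simpa only [hM00, Polynomial.finsetSum_coeff, Polynomial.coeff_C_mul, Polynomial.coeff_mul_C,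
      Polynomial.coeff_zero] using h1
  have hu : fv 0 none ≠ 0 := by
    have := hq z hz
    simp only [hfv, hf]
    rw [Polynomial.coeff_zero_eq_eval_zero, lineP_eval]
    simpa using this
  constructor
  · -- dimension count
    have h1 : LinearIndependent ℂ (Fin.cons (Pi.single none 1)
        (fun (k : Fin (r + 1)) => fv k) : Fin (r + 2) → Option (Fin N) → ℂ) := by
      rw [linearIndependent_finCons]
      refine ⟨hli, fun hmem => ?_⟩
      have hsub : Submodule.span ℂ (Set.range fun (k : Fin (r + 1)) => fv k) ≤
          LinearMap.ker (Fintype.linearCombination ℂ (fun j => eps j * star (fv 0 j))) := by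
        rw [Submodule.span_le]
        rintro _ ⟨k, rfl⟩
        simp only [SetLike.mem_coe, LinearMap.mem_ker, Fintype.linearCombination_apply, smul_eq_mul]
        rw [← horth k]
        exact Finset.sum_congr rfl fun j _ => by ring
      have h2 := hsub hmem
      rw [LinearMap.mem_ker, Fintype.linearCombination_apply_single] at h2
      simp [eps] at h2
      exact hu h2
    have h3 := h1.fintype_card_le_finrank
    simp at h3
    omega
  · -- degree bound
    have hα : ∀ K : ℕ, ∃ α : Fin (r + 1) → ℂ, ∑ i, α i • fv i = fv K := fun K =>
      (Submodule.mem_span_range_iff_exists_fun ℂ).1 (hspan K)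
    choose α hα using hα
    let a : Fin (r + 1) → Polynomial ℂ := fun i =>
      ∑ K ∈ Finset.range (D + 1), Polynomial.C (α K i) * Polynomial.X ^ K
    have hac : ∀ i K, K ≤ D → (a i).coeff K = α K i := by
      intro i K hK
      simp only [a, Polynomial.finsetSum_coeff, Polynomial.coeff_C_mul, Polynomial.coeff_X_pow]
      rw [Finset.sum_eq_single K]
      · simp
      · intro b _ hb; simp [hb.symm]
      · intro h; simp at h; omega
    have hac2 : ∀ i K, D < K → (a i).coeff K = 0 := by
      intro i K hK
      simp only [a, Polynomial.finsetSum_coeff, Polynomial.coeff_C_mul, Polynomial.coeff_X_pow]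
      apply Finset.sum_eq_zero
      intro b hb
      have : K ≠ b := by simp at hb; omega
      simp [this]
    have hfa : ∀ j, f j = ∑ i, a i * Polynomial.C (fv i j) := by
      intro j
      ext K
      simp only [Polynomial.finsetSum_coeff, Polynomial.coeff_mul_C]
      by_cases hK : K ≤ D
      · have := congrFun (hα K) j
        simp only [Finset.sum_apply, Pi.smul_apply, smul_eq_mul] at this
        simp only [hac _ _ hK]
        exact this.symm
      · push Not at hK
        simp only [hac2 _ _ hK, zero_mul, Finset.sum_const_zero]
        exact Polynomial.coeff_eq_zero_of_natDegree_lt ((hdeg _ _ j).trans_lt hK)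
    let T : Matrix (Fin r) (Fin r) (Polynomial ℂ) := Matrix.of fun k i =>
      ∑ j, Polynomial.C (eps j * fv (i + 1) j) * (M j).coeff (k + 1)
    let T0 : Fin r → Polynomial ℂ := fun k =>
      ∑ j, Polynomial.C (eps j * fv 0 j) * (M j).coeff (k + 1)
    have hMd : ∀ (c : Option (Fin N) → ℂ) (k : ℕ),
        (∑ j, Polynomial.C (c j) * (M j).coeff k).natDegree ≤ k := by
      intro c k
      refine Polynomial.natDegree_sum_le_of_forall_le _ _ fun j _ => ?_
      exact (Polynomial.natDegree_C_mul_le _ _).trans (twoP_natDegree _ _ _ _)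
    have hdet : T.det ≠ 0 := by
      intro h0
      have h1 := congrArg (Polynomial.evalRingHom 0) h0
      rw [RingHom.map_det, map_zero] at h1
      obtain ⟨c, hc, hc2⟩ := Matrix.exists_mulVec_eq_zero_iff.2 h1
      let x : Option (Fin N) → ℂ := fun j => ∑ i, c i * fv (i + 1) j
      have hx : ∀ k : Fin r, ∑ j, eps j * x j * star (fv (k + 1) j) = 0 := by
        intro k
        have h2 := congrFun hc2 k
        simp only [Matrix.mulVec, dotProduct, RingHom.mapMatrix_apply, Matrix.map_apply, T,
          Matrix.of_apply, Pi.zero_apply, Polynomial.coe_evalRingHom, Polynomial.eval_finsetSum,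
          Polynomial.eval_mul, Polynomial.eval_C, hM0, Finset.sum_mul] at h2
        rw [Finset.sum_comm] at h2
        rw [← h2]
        refine Finset.sum_congr rfl fun j _ => ?_
        simp only [x, Finset.mul_sum, Finset.sum_mul]
        exact Finset.sum_congr rfl fun i _ => by ring
      have hxx : ∑ j, eps j * x j * star (x j) = 0 := by
        have : ∀ j, eps j * x j * star (x j) =
            ∑ k : Fin r, star (c k) * (eps j * x j * star (fv (k + 1) j)) := by
          intro j
          conv_lhs => rw [show star (x j) = ∑ k : Fin r, star (c k) * star (fv (k + 1) j) by
            simp only [x, star_sum, star_mul']]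
          rw [Finset.mul_sum]
          exact Finset.sum_congr rfl fun i _ => by ring
        simp_rw [this]
        rw [Finset.sum_comm]
        simp_rw [← Finset.mul_sum, hx]
        simp
      have hxu : ∑ j, eps j * x j * star (fv 0 j) = 0 := by
        have : ∀ j, eps j * x j * star (fv 0 j) =
            ∑ k : Fin r, c k * (eps j * fv (k + 1) j * star (fv 0 j)) := by
          intro j
          simp only [x, Finset.mul_sum, Finset.sum_mul]
          exact Finset.sum_congr rfl fun i _ => by ring
        simp_rw [this]
        rw [Finset.sum_comm]
        simp_rw [← Finset.mul_sum, horth]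
        simp
      obtain ⟨l, hl⟩ := null_prop (fv 0) x hu (horth 0) hxu hxx
      have h3 := Fintype.linearIndependent_iff.1 hli (Fin.cons (-l) c) (by
        rw [Fin.sum_univ_succ]
        ext j
        have h4 := congrFun hl j
        simp only [x, Pi.smul_apply, smul_eq_mul] at h4
        simp only [Fin.cons_zero, Fin.cons_succ, Pi.add_apply, Pi.smul_apply, smul_eq_mul,
          Finset.sum_apply, Fin.val_succ, Fin.val_zero, Pi.zero_apply]
        change -l * fv 0 j + ∑ i, c i * fv (i + 1) j = 0
        rw [h4]; ring)
      apply hc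
      ext i
      simpa using h3 i.succ
    have heq : ∀ k, a 0 * T0 k + ∑ i, T k i * a i.succ = 0 := by
      intro k
      have h1 := hrel (k + 1)
      have h2 : ∀ j, Polynomial.C (eps j) * f j * (M j).coeff (k + 1) =
          ∑ i : Fin (r + 1), a i * (Polynomial.C (eps j * fv i j) * (M j).coeff (k + 1)) := by
        intro j
        rw [hfa j, Finset.mul_sum, Finset.sum_mul]
        refine Finset.sum_congr rfl fun i _ => ?_
        rw [Polynomial.C_mul]; ring
      simp_rw [h2] at h1
      rw [Finset.sum_comm, Fin.sum_univ_succ] at h1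
      simp_rw [← Finset.mul_sum] at h1
      rw [← h1]
      congr 1
      refine Finset.sum_congr rfl fun i _ => ?_
      rw [mul_comm]
      rfl
    have hTd : ∀ k i : Fin r, (T k i).natDegree ≤ (k : ℕ) + 1 := fun k i =>
      hMd (fun j => eps j * fv (i + 1) j) (k + 1)
    have hT0d : ∀ k : Fin r, (T0 k).natDegree ≤ (k : ℕ) + 1 := fun k =>
      hMd (fun j => eps j * fv 0 j) (k + 1)
    obtain ⟨hb0, hb⟩ := cramer_bound r (a 0) (fun i => a i.succ) T T0
      hTd hT0d hdet heq (by
        intro s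
        by_contra! h0
        obtain ⟨j, hj⟩ := hg.2.1 s
        apply hj
        change (f j).eval s = 0
        rw [hfa j, Polynomial.eval_finsetSum, Fin.sum_univ_succ]
        simp [h0.1, h0.2])
    obtain ⟨j, hj⟩ := hg.2.2
    have hj' : (f j).coeff D ≠ 0 := hj
    rw [hfa j, Polynomial.finsetSum_coeff] at hj'
    obtain ⟨i, -, hi⟩ := Finset.exists_ne_zero_of_sum_ne_zero hj'
    rw [Polynomial.coeff_mul_C] at hi
    have hi2 := Polynomial.le_natDegree_of_ne_zero (left_ne_zero_of_mul hi)
    refine hi2.trans ?_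
    induction i using Fin.cases with
    | zero => exact hb0
    | succ i => exact hb i

/-- Degree estimate for rational proper maps between balls: if `n ≥ 2`, `N ≥ 2`,
and `f = p/q` is a rational proper map from `B_n` to `B_N` in lowest terms of
degree `d`, then `d ≤ N(N-1)/(2(2n-3))`. -/
theorem degree_bound_rational (n N : ℕ) (hn : 2 ≤ n) (hN : 2 ≤ N)
    (p : Fin N → MvPolynomial (Fin n) ℂ) (q : MvPolynomial (Fin n) ℂ)
    (hpq : IsRationalProperBallMap n N p q) (d : ℕ)
    (hd : rationalDegree n N p q = d) :
    (d : ℝ) ≤ ((N : ℝ) * ((N : ℝ) - 1)) / (2 * (2 * (n : ℝ) - 3)) := by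
  obtain ⟨ν, rfl⟩ : ∃ ν, n = ν + 2 := ⟨n - 2, by omega⟩
  have hpos : (0 : ℝ) < 2 * (2 * ((ν + 2 : ℕ) : ℝ) - 3) := by
    have : (0 : ℝ) ≤ ν := Nat.cast_nonneg ν
    push_cast
    linarith
  have hN1 : (2 : ℝ) ≤ N := by exact_mod_cast hN
  rw [le_div_iff₀ hpos]
  by_cases hd0 : d = 0
  · subst hd0
    rw [Nat.cast_zero, zero_mul]
    exact mul_nonneg (by linarith) (by linarith)
  obtain ⟨hq, hcop, -, hsph⟩ := hpq
  let F : Option (Fin N) → MvPolynomial (Fin (ν + 2)) ℂ := fun j => j.elim q p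
  have hFd : ∀ j, (F j).totalDegree ≤ d := by
    intro j
    rw [← hd]
    cases j with
    | none => exact le_max_right _ _
    | some i =>
      exact le_max_of_le_left
        (Finset.le_sup (f := fun i => (p i).totalDegree) (Finset.mem_univ i))
  have hFd' : ∃ j, (F j).totalDegree = d := by
    rcases le_total (Finset.univ.sup fun i => (p i).totalDegree) q.totalDegree with h | h
    · exact ⟨none, by rw [← hd, rationalDegree, max_eq_right h]; rfl⟩
    · have hne : (Finset.univ : Finset (Fin N)).Nonempty := ⟨⟨0, by omega⟩, Finset.mem_univ _⟩
      obtain ⟨i, -, hi⟩ := Finset.exists_mem_eq_sup _ hne (fun i => (p i).totalDegree)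
      exact ⟨some i, by rw [← hd, rationalDegree, max_eq_left h, hi]; rfl⟩
  obtain ⟨U, hU, hgood⟩ := exists_good_unitary F d hd0 hFd hFd'
    (fun r hr => hcop r (hr none) (fun i => hr (some i)))
  -- points of the small sphere go to points of the big sphere
  have hpt : ∀ w : Fin 2 → ℂ, w 0 * star (w 0) + w 1 * star (w 1) = 1 →
      ∃ z : EuclideanSpace ℂ (Fin (ν + 2)), ‖z‖ = 1 ∧
        ∀ P, eval w (pullG U P) = eval (fun i => z i) P := by
    intro w hw
    have hw2 : ‖w 0‖ ^ 2 + ‖w 1‖ ^ 2 = 1 := by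
      have h1 : ((‖w 0‖ ^ 2 + ‖w 1‖ ^ 2 : ℝ) : ℂ) = 1 := by
        rw [← hw, Complex.ofReal_add, Complex.ofReal_pow, Complex.ofReal_pow,
          ← Complex.mul_conj', ← Complex.mul_conj']
        rfl
      exact_mod_cast h1
    refine ⟨WithLp.toLp 2 (U.mulVec (fun k => eval w (gmap ν k))), ?_, fun P => ?_⟩
    · rw [EuclideanSpace.norm_eq]
      simp only
      rw [unitary_norm U hU, gmap_norm ν w hw2, Real.sqrt_one]
    · rw [pullG_eval]
  obtain ⟨r, hr, hD⟩ := two_dim_bound (fun j => pullG U (F j)) (by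
      intro w hw
      obtain ⟨z, hz, hz2⟩ := hpt w hw
      have h1 := hsph z hz
      simp only [hz2]
      rw [Fintype.sum_option]
      have h2 : ∀ c : ℂ, c * star c = ((‖c‖ ^ 2 : ℝ) : ℂ) := fun c => by
        rw [Complex.ofReal_pow, ← Complex.mul_conj']; rfl
      simp only [eps, mul_assoc, h2, F, Option.elim]
      rw [← h1, Complex.ofReal_sum]
      simp) (by
      intro w hw
      obtain ⟨z, hz, hz2⟩ := hpt w hw
      rw [hz2]
      exact hq z hz.le) (d * (2 * ν + 1)) (by positivity)
      (fun z v j => lineP_pullG_natDegree _ _ _ _ _ (hFd j)) hgood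
  have h1 : 2 * (d * (2 * ν + 1)) ≤ r * (r + 1) := by omega
  have h2 : (2 : ℝ) * (d * (2 * ν + 1)) ≤ r * (r + 1) := by exact_mod_cast h1
  have h3 : (r : ℝ) + 1 ≤ N := by exact_mod_cast hr
  have h4 : (0 : ℝ) ≤ r := Nat.cast_nonneg r
  have h5 : (r : ℝ) * (r + 1) ≤ (N - 1) * N :=
    mul_le_mul (by linarith) h3 (by linarith) (by linarith)
  push_cast
  linarith
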